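/- Let H be a finite-dimensional Hopf algebra over a field of characteristic 0. Then H is semisimple if and only if H is cosemisimple, if and only if S_H^2 = id_H, if and only if tr(S_H^2) ≠ 0. -/

import Mathlib

open TensorProduct

/-- A subspace `V` of a coalgebra `H` is a subcoalgebra if `Δ(V) ⊆ V ⊗ V` inside `H ⊗ H`. -/
def IsSubcoalgebra (k : Type*) {H : Type*} [CommRing k] [AddCommGroup H] [Module k H]
    [Coalgebra k H] (V : Submodule k H) : Prop :=
  ∀ x ∈ V, Coalgebra.comul (R := k) x ∈
    LinearMap.range (TensorProduct.map V.subtype V.subtype)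

/-- A coalgebra is cosemisimple if it is the sum of its simple subcoalgebras. -/
def IsCosemisimple (k H : Type*) [CommRing k] [AddCommGroup H] [Module k H]
    [Coalgebra k H] : Prop :=
  sSup {V : Submodule k H | IsSubcoalgebra k V ∧ V ≠ ⊥ ∧
    ∀ W ≤ V, IsSubcoalgebra k W → W = ⊥ ∨ W = V} = ⊤

noncomputable section

open Coalgebra

section Contract
variable {k H D M N : Type*} [Field k] [AddCommGroup H] [Module k H]
  [AddCommMonoid D] [Module k D]
  [AddCommMonoid M] [Module k M] [AddCommMonoid N] [Module k N]
  (φ : D ≃ₗ[k] Module.Dual k H)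

/-- Evaluation of the first tensor factor at a vector, for a space `D` identified with the
dual of `H`. -/
def evalLeft (x : H) : D ⊗[k] M →ₗ[k] M :=
  TensorProduct.lift ((LinearMap.lsmul k M) ∘ₗ (LinearMap.applyₗ x) ∘ₗ φ.toLinearMap)

@[simp] lemma evalLeft_tmul (x : H) (p : D) (m : M) :
    evalLeft φ x (p ⊗ₜ[k] m) = φ p x • m := rfl

lemma evalLeft_lTensor (x : H) (f : M →ₗ[k] N) (t : D ⊗[k] M) :
    evalLeft φ x (f.lTensor _ t) = f (evalLeft φ x t) := by
  induction t with
  | zero => simp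
  | tmul p m => simp
  | add a b ha hb => simp [ha, hb]

lemma evalLeft_ext [FiniteDimensional k H] {s t : D ⊗[k] M}
    (h : ∀ x, evalLeft φ x s = evalLeft φ x t) : s = t := by
  let b := Module.finBasis k H
  have key : ∀ u : D ⊗[k] M, u = ∑ i, φ.symm (b.coord i) ⊗ₜ[k] evalLeft φ (b i) u := by
    intro u
    induction u with
    | zero => simp
    | tmul p m =>
      simp only [evalLeft_tmul, ← TensorProduct.smul_tmul, ← TensorProduct.sum_tmul]
      congr 1
      apply φ.injective
      ext x
      have hx := congrArg (φ p) (b.sum_repr x)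
      simp only [map_sum, map_smul] at hx
      simp [← hx]
    | add a c ha hc =>
      conv_lhs => rw [ha, hc]
      simp [TensorProduct.tmul_add, Finset.sum_add_distrib]
  rw [key s, key t]
  simp [h]

lemma evalLeft_assoc (x y : H) (s : D ⊗[k] D) (q : D) :
    evalLeft φ y (evalLeft φ x (TensorProduct.assoc k _ _ _ (s ⊗ₜ[k] q))) =
      φ (evalLeft φ x s) y • q := by
  induction s with
  | zero => simp
  | tmul p m => simp [smul_smul]
  | add a b ha hb => simp [TensorProduct.add_tmul, ha, hb, add_smul]

end Contract

/-- The dual of a finite-dimensional Hopf algebra, as a Hopf algebra. -/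
def HopfDual (k H : Type*) [Field k] [Ring H] [HopfAlgebra k H] : Type _ :=
  WithConv (H →ₗ[k] k)

namespace HopfDual
variable {k H : Type*} [Field k] [Ring H] [HopfAlgebra k H]

instance : Ring (HopfDual k H) := inferInstanceAs (Ring (WithConv (H →ₗ[k] k)))

instance : Algebra k (HopfDual k H) := inferInstanceAs (Algebra k (WithConv (H →ₗ[k] k)))

/-- The identification of `HopfDual k H` with the space of linear forms on `H`. -/
def toDual : HopfDual k H ≃ₗ[k] Module.Dual k H := WithConv.linearEquiv k (H →ₗ[k] k)

local notation "φ" => toDual (k := _) (H := _)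

lemma mul_eval {x : H} {ι : Type*} (r : Coalgebra.Repr k x ι) (p q : HopfDual k H) :
    φ (p * q) x = ∑ i ∈ r.index, φ p (r.left i) * φ q (r.right i) :=
  r.convMul_apply _ _

lemma one_apply (x : H) : φ (1 : HopfDual k H) x = counit (R := k) x := by
  change algebraMap k k (counit x) = _
  rfl

lemma evalLeft_mul (x : H) (s t : HopfDual k H ⊗[k] HopfDual k H) :
    evalLeft toDual x (s * t) = ∑ i ∈ (ℛ k x).index,
      evalLeft toDual ((ℛ k x).left i) s * evalLeft toDual ((ℛ k x).right i) t := by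
  induction s with
  | zero => simp
  | add a b ha hb => simp [ha, hb, add_mul, Finset.sum_add_distrib]
  | tmul p q =>
    induction t with
    | zero => simp
    | add a b ha hb =>
      rw [mul_add, map_add, ha, hb]
      simp [mul_add, Finset.sum_add_distrib]
    | tmul p' q' =>
      simp only [Algebra.TensorProduct.tmul_mul_tmul, evalLeft_tmul, mul_eval (ℛ k x),
        Finset.sum_smul, smul_mul_smul_comm]

/-- The antipode of the dual, as the transpose of the antipode. -/
def antipodeDual : HopfDual k H →ₗ[k] HopfDual k H :=
  toDual.symm.toLinearMap ∘ₗ (HopfAlgebra.antipode k (A := H)).dualMap ∘ₗ toDual.toLinearMap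

lemma antipodeDual_apply (p : HopfDual k H) (x : H) :
    φ (antipodeDual p) x = φ p (HopfAlgebra.antipode k x) := rfl

variable [FiniteDimensional k H]

instance : FiniteDimensional k (HopfDual k H) :=
  Module.Finite.equiv (toDual (k := k) (H := H)).symm

instance : CoalgebraStruct k (HopfDual k H) where
  comul := ∑ i, (TensorProduct.mk k _ _ (toDual.symm ((Module.finBasis k H).coord i))) ∘ₗ
    toDual.symm.toLinearMap ∘ₗ
    (LinearMap.mulLeft k (Module.finBasis k H i)).dualMap ∘ₗ toDual.toLinearMap
  counit := LinearMap.applyₗ 1 ∘ₗ toDual.toLinearMap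

lemma counit_apply (p : HopfDual k H) : counit (R := k) p = φ p 1 := rfl

lemma evalLeft_comul (x : H) (p : HopfDual k H) :
    evalLeft toDual x (comul (R := k) p) = toDual.symm (φ p ∘ₗ LinearMap.mulLeft k x) := by
  apply toDual.injective
  ext y
  have hx := congrArg (φ p ∘ₗ LinearMap.mulRight k y) ((Module.finBasis k H).sum_repr x)
  simp only [map_sum, map_smul, LinearMap.comp_apply, LinearMap.mulRight_apply] at hx
  simpa [comul, LinearMap.dualMap_apply'] using hx

lemma apply_evalLeft_comul (x y : H) (p : HopfDual k H) :
    φ (evalLeft toDual x (comul (R := k) p)) y = φ p (x * y) := by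
  simp [evalLeft_comul]

instance : Coalgebra k (HopfDual k H) where
  coassoc := by
    ext p : 1
    refine evalLeft_ext toDual fun x => evalLeft_ext toDual fun y => ?_
    have key : ∀ t : HopfDual k H ⊗[k] HopfDual k H,
        evalLeft toDual y (evalLeft toDual x
          (TensorProduct.assoc k _ _ _ (comul.rTensor _ t))) = evalLeft toDual (x * y) t := by
      intro t
      induction t with
      | zero => simp
      | tmul p q => simp [evalLeft_assoc, evalLeft_comul]
      | add a b ha hb => simp [ha, hb]
    simp only [LinearMap.comp_apply, LinearEquiv.coe_coe, key, evalLeft_lTensor, evalLeft_comul]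
    apply toDual.injective
    ext z
    simp
  rTensor_counit_comp_comul := by
    ext p : 1
    have key : ∀ t : HopfDual k H ⊗[k] HopfDual k H,
        counit.rTensor _ t = 1 ⊗ₜ[k] evalLeft toDual 1 t := by
      intro t
      induction t with
      | zero => simp
      | tmul p q => simp [counit_apply, TensorProduct.smul_tmul']
      | add a b ha hb => simp [ha, hb, TensorProduct.tmul_add]
    simp only [LinearMap.comp_apply, key, evalLeft_comul, TensorProduct.mk_apply]
    congr 1
    apply toDual.injective
    ext; simp
  lTensor_counit_comp_comul := by
    ext p : 1
    refine evalLeft_ext toDual fun x => ?_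
    simp [evalLeft_lTensor, evalLeft_comul, counit_apply]

instance : Bialgebra k (HopfDual k H) :=
  Bialgebra.mk' k _ (by simp [counit_apply, one_apply])
    (by
      intro a b
      rw [counit_apply, counit_apply, counit_apply,
        mul_eval (⟨{()}, fun _ => 1, fun _ => 1,
          by simp [Algebra.TensorProduct.one_def]⟩ : Coalgebra.Repr k (1 : H) Unit)]
      simp)
    (by
      refine evalLeft_ext toDual fun x => ?_
      rw [evalLeft_comul, Algebra.TensorProduct.one_def, evalLeft_tmul]
      apply toDual.injective
      ext y
      simp [one_apply])
    (by
      intro a b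
      refine evalLeft_ext toDual fun x => ?_
      rw [evalLeft_mul]
      apply toDual.injective
      ext y
      simp only [evalLeft_comul, map_sum, LinearMap.sum_apply, LinearEquiv.apply_symm_apply,
        LinearMap.comp_apply, LinearMap.mulLeft_apply, mul_eval (ℛ k y)]
      rw [mul_eval ((ℛ k x).mul (ℛ k y))]
      simp [Coalgebra.Repr.mul, Coalgebra.Repr.tmul, Finset.sum_product])

instance : HopfAlgebra k (HopfDual k H) where
  antipode := antipodeDual
  mul_antipode_rTensor_comul := by
    ext p
    apply toDual.injective
    ext x
    have key : ∀ t : HopfDual k H ⊗[k] HopfDual k H,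
        φ (LinearMap.mul' k _ (antipodeDual.rTensor _ t)) x =
        ∑ i ∈ (ℛ k x).index, φ (evalLeft toDual (HopfAlgebra.antipode k ((ℛ k x).left i)) t)
          ((ℛ k x).right i) := by
      intro t
      induction t with
      | zero => simp
      | add a b ha hb => simp only [map_add, LinearMap.add_apply, ha, hb, Finset.sum_add_distrib]
      | tmul p q => simp [mul_eval (ℛ k x), antipodeDual_apply]
    simp only [LinearMap.comp_apply] at key ⊢
    rw [key]
    simp only [apply_evalLeft_comul]
    rw [← map_sum, HopfAlgebra.sum_antipode_mul_eq_smul]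
    simp [counit_apply, mul_comm, one_apply, Algebra.algebraMap_eq_smul_one]
  mul_antipode_lTensor_comul := by
    ext p
    apply toDual.injective
    ext x
    have key : ∀ t : HopfDual k H ⊗[k] HopfDual k H,
        φ (LinearMap.mul' k _ (antipodeDual.lTensor _ t)) x =
        ∑ i ∈ (ℛ k x).index, φ (evalLeft toDual ((ℛ k x).left i) t)
          (HopfAlgebra.antipode k ((ℛ k x).right i)) := by
      intro t
      induction t with
      | zero => simp
      | add a b ha hb => simp only [map_add, LinearMap.add_apply, ha, hb, Finset.sum_add_distrib]
      | tmul p q => simp [mul_eval (ℛ k x), antipodeDual_apply]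
    simp only [LinearMap.comp_apply] at key ⊢
    rw [key]
    simp only [apply_evalLeft_comul]
    rw [← map_sum, HopfAlgebra.sum_mul_antipode_eq_smul]
    simp [counit_apply, mul_comm, one_apply, Algebra.algebraMap_eq_smul_one]

lemma antipode_apply (p : HopfDual k H) (x : H) :
    φ (HopfAlgebra.antipode k p) x = φ p (HopfAlgebra.antipode k x) := rfl

lemma trace_antipode_sq :
    LinearMap.trace k (HopfDual k H)
      (HopfAlgebra.antipode k ∘ₗ HopfAlgebra.antipode k) =
    LinearMap.trace k H (HopfAlgebra.antipode k ∘ₗ HopfAlgebra.antipode k) := by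
  rw [← LinearMap.trace_transpose' (R := k) (M := H)
    (HopfAlgebra.antipode k (A := H) ∘ₗ HopfAlgebra.antipode k (A := H)),
    ← LinearMap.trace_conj' _ (toDual (k := k) (H := H))]
  rfl

end HopfDual

section Separability
variable {k A E M : Type*} [Field k] [Ring A] [Algebra k A] [Ring E] [Algebra k E]
  [AddCommGroup M] [Module k M]

/-- `e` is a separability idempotent of the algebra `A`. -/
structure IsSeparabilityTensor (e : A ⊗[k] A) : Prop where
  mul'_eq_one : LinearMap.mul' k A e = 1
  tmul_one_mul (a : A) : (a ⊗ₜ[k] 1) * e = e * (1 ⊗ₜ[k] a)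

/-- The map `a ⊗ b ↦ ρ a * P * ρ b`. -/
def sandwich (ρ : A →ₐ[k] E) (P : E) : A ⊗[k] A →ₗ[k] E :=
  TensorProduct.lift (((LinearMap.mul k E).comp (LinearMap.mulRight k P)).compl₁₂
    ρ.toLinearMap ρ.toLinearMap)

@[simp] lemma sandwich_tmul (ρ : A →ₐ[k] E) (P : E) (a b : A) :
    sandwich ρ P (a ⊗ₜ[k] b) = ρ a * P * ρ b := rfl

lemma sandwich_tmul_one_mul (ρ : A →ₐ[k] E) (P : E) (a : A) (t : A ⊗[k] A) :
    sandwich ρ P ((a ⊗ₜ[k] 1) * t) = ρ a * sandwich ρ P t := by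
  induction t with
  | zero => simp
  | tmul x y => simp [mul_assoc]
  | add x y hx hy => simp [mul_add, hx, hy]

lemma sandwich_mul_one_tmul (ρ : A →ₐ[k] E) (P : E) (a : A) (t : A ⊗[k] A) :
    sandwich ρ P (t * (1 ⊗ₜ[k] a)) = sandwich ρ P t * ρ a := by
  induction t with
  | zero => simp
  | tmul x y => simp [mul_assoc]
  | add x y hx hy => simp [add_mul, hx, hy]

lemma IsSeparabilityTensor.commute {e : A ⊗[k] A} (he : IsSeparabilityTensor e)
    (ρ : A →ₐ[k] E) (P : E) (a : A) : Commute (ρ a) (sandwich ρ P e) := by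
  rw [Commute, SemiconjBy, ← sandwich_tmul_one_mul, he.tmul_one_mul, sandwich_mul_one_tmul]

lemma commute_sandwich (ρ : A →ₐ[k] E) {P Q : E} (hP : Commute Q P)
    (hρ : ∀ a, Commute Q (ρ a)) (t : A ⊗[k] A) : Commute Q (sandwich ρ P t) := by
  induction t with
  | zero => simp
  | tmul x y => exact ((hρ x).mul_right hP).mul_right (hρ y)
  | add x y hx hy => simpa using hx.add_right hy

lemma sandwich_apply_mem (ρ : A →ₐ[k] Module.End k M) {N : Submodule k M}
    (hN : ∀ a, ∀ x ∈ N, ρ a x ∈ N) {P : Module.End k M} (hP : ∀ x, P x ∈ N) (t : A ⊗[k] A)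
    (x : M) : sandwich ρ P t x ∈ N := by
  induction t with
  | zero => simp
  | tmul a b => exact hN _ _ (hP _)
  | add a b ha hb => simpa using N.add_mem ha hb

lemma sandwich_apply_eq (ρ : A →ₐ[k] Module.End k M) {N : Submodule k M}
    (hN : ∀ a, ∀ x ∈ N, ρ a x ∈ N) {P : Module.End k M} (hP : ∀ x ∈ N, P x = x) (t : A ⊗[k] A)
    {x : M} (hx : x ∈ N) : sandwich ρ P t x = ρ (LinearMap.mul' k A t) x := by
  induction t with
  | zero => simp
  | tmul a b => simp [hP _ (hN b x hx)]
  | add a b ha hb => simp [ha, hb]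

lemma IsSeparabilityTensor.sandwich_apply_eq_self {e : A ⊗[k] A} (he : IsSeparabilityTensor e)
    (ρ : A →ₐ[k] Module.End k M) {N : Submodule k M}
    (hN : ∀ a, ∀ x ∈ N, ρ a x ∈ N) {P : Module.End k M} (hP : ∀ x ∈ N, P x = x)
    {x : M} (hx : x ∈ N) : sandwich ρ P e x = x := by
  rw [sandwich_apply_eq ρ hN hP e hx, he.mul'_eq_one, map_one, Module.End.one_apply]

lemma exists_projection (N : Submodule k M) :
    ∃ P : Module.End k M, (∀ x, P x ∈ N) ∧ ∀ x ∈ N, P x = x := by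
  obtain ⟨f, hf⟩ := N.subtype.exists_leftInverse_of_injective (by simp)
  exact ⟨N.subtype ∘ₗ f, fun x => (f x).2, fun x hx => by
    simpa using congrArg Subtype.val (LinearMap.congr_fun hf ⟨x, hx⟩)⟩

lemma isCompl_ker_of_projection {R : Type*} [Ring R] [Module R M] {N : Submodule R M}
    {P : M →ₗ[R] M} (h₁ : ∀ x, P x ∈ N) (h₂ : ∀ x ∈ N, P x = x) :
    IsCompl N (LinearMap.ker P) := by
  have h := LinearMap.isCompl_of_proj (f := P.codRestrict N h₁)
    (fun x => Subtype.ext (h₂ x x.2))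
  rwa [LinearMap.ker_codRestrict] at h

lemma IsSeparabilityTensor.isSemisimpleRing {e : A ⊗[k] A} (he : IsSeparabilityTensor e) :
    IsSemisimpleRing A := by
  refine (isSemisimpleModule_iff ..).2 ⟨fun N => ?_⟩
  obtain ⟨P, hP₁, hP₂⟩ := exists_projection (N.restrictScalars k)
  have hN : ∀ a, ∀ x ∈ N.restrictScalars k, Algebra.lmul k A a x ∈ N.restrictScalars k :=
    fun a x hx => N.smul_mem a hx
  let Q : A →ₗ[A] A :=
    { toFun := sandwich (Algebra.lmul k A) P e
      map_add' := map_add _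
      map_smul' := fun a x =>
        (LinearMap.congr_fun (he.commute (Algebra.lmul k A) P a) x).symm }
  exact ⟨_, isCompl_ker_of_projection (P := Q) (sandwich_apply_mem _ hN hP₁ e)
    (fun x hx => he.sandwich_apply_eq_self _ hN hP₂ hx)⟩

/-- The flip `A ⊗ A → Aᵐᵒᵖ ⊗ Aᵐᵒᵖ`. -/
def flipOp : A ⊗[k] A →ₗ[k] Aᵐᵒᵖ ⊗[k] Aᵐᵒᵖ :=
  TensorProduct.map (MulOpposite.opLinearEquiv k).toLinearMap
    (MulOpposite.opLinearEquiv k).toLinearMap ∘ₗ (TensorProduct.comm k A A).toLinearMap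

@[simp] lemma flipOp_tmul (a b : A) :
    flipOp (k := k) (a ⊗ₜ[k] b) = MulOpposite.op b ⊗ₜ[k] MulOpposite.op a := rfl

/-- The flipped tensor is a separability tensor of the opposite algebra. -/
lemma IsSeparabilityTensor.op {e : A ⊗[k] A} (he : IsSeparabilityTensor e) :
    IsSeparabilityTensor (flipOp e) := by
  have h₁ : ∀ t : A ⊗[k] A,
      LinearMap.mul' k Aᵐᵒᵖ (flipOp t) = MulOpposite.op (LinearMap.mul' k A t) := by
    intro t
    induction t with
    | zero => simp
    | tmul a b => simp
    | add a b ha hb => simp [ha, hb]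
  have h₂ : ∀ (a : A) (t : A ⊗[k] A),
      flipOp ((a ⊗ₜ[k] 1) * t) = flipOp t * (1 ⊗ₜ[k] MulOpposite.op a) := by
    intro a t
    induction t with
    | zero => simp
    | tmul a b => simp
    | add a b ha hb => simp [ha, hb, mul_add, add_mul]
  have h₃ : ∀ (a : A) (t : A ⊗[k] A),
      flipOp (t * (1 ⊗ₜ[k] a)) = (MulOpposite.op a ⊗ₜ[k] 1) * flipOp t := by
    intro a t
    induction t with
    | zero => simp
    | tmul a b => simp
    | add a b ha hb => simp [ha, hb, mul_add, add_mul]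
  constructor
  · rw [h₁, he.mul'_eq_one, MulOpposite.op_one]
  · intro a
    rw [← MulOpposite.op_unop a, ← h₂, ← h₃, he.tmul_one_mul]

end Separability

section Integrals
variable {k H : Type*} [Field k] [Ring H] [HopfAlgebra k H]

/-- Left integrals of an augmented algebra. -/
def IsLeftIntegral (k : Type*) {H : Type*} [Field k] [Ring H] [HopfAlgebra k H] (Λ : H) : Prop :=
  ∀ h : H, h * Λ = counit (R := k) h • Λ

/-- Right integrals of an augmented algebra. -/
def IsRightIntegral (k : Type*) {H : Type*} [Field k] [Ring H] [HopfAlgebra k H] (Λ : H) : Prop :=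
  ∀ h : H, Λ * h = counit (R := k) h • Λ

local notation "𝑺" => HopfAlgebra.antipode k (A := H)
local notation "Δ" => comul (R := k) (A := H)

open WithConv

section Convolution
variable {B : Type*} [Ring B] [Algebra k B]

lemma comp_antipode_convMul (f : H →ₐ[k] B) :
    toConv (f.toLinearMap ∘ₗ 𝑺) * toConv f.toLinearMap = 1 := by
  have h := LinearMap.algHom_comp_convMul_distrib f (toConv 𝑺) (toConv LinearMap.id)
  rw [LinearMap.antipode_mul_id] at h
  rw [← toConv_ofConv (_ * _)]
  refine (congrArg toConv h).symm.trans ?_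
  ext x
  simp

lemma convMul_comp_antipode (f : H →ₐ[k] B) :
    toConv f.toLinearMap * toConv (f.toLinearMap ∘ₗ 𝑺) = 1 := by
  have h := LinearMap.algHom_comp_convMul_distrib f (toConv LinearMap.id) (toConv 𝑺)
  rw [LinearMap.id_mul_antipode] at h
  rw [← toConv_ofConv (_ * _)]
  refine (congrArg toConv h).symm.trans ?_
  ext x
  simp

end Convolution

variable (k H) in
/-- The inclusion `a ↦ a ⊗ 1` in the convolution algebra. -/
def convLeft : WithConv (H →ₗ[k] H ⊗[k] H) :=
  toConv (Algebra.TensorProduct.includeLeft (R := k) (S := k) (A := H) (B := H)).toLinearMap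

variable (k H) in
/-- The inclusion `a ↦ 1 ⊗ a` in the convolution algebra. -/
def convRight : WithConv (H →ₗ[k] H ⊗[k] H) :=
  toConv (Algebra.TensorProduct.includeRight (R := k) (A := H) (B := H)).toLinearMap

lemma convLeft_mul_convRight : convLeft k H * convRight k H = toConv Δ := by
  ext x
  rw [(ℛ k x).convMul_apply]
  simp [convLeft, convRight, (ℛ k x).eq]

lemma sum_antipode_tmul_mul_comul (h : H) :
    ∑ i ∈ (ℛ k h).index, (𝑺 ((ℛ k h).left i) ⊗ₜ[k] (1 : H)) * Δ ((ℛ k h).right i) =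
      1 ⊗ₜ[k] h := by
  have := comp_antipode_convMul
    (Algebra.TensorProduct.includeLeft (R := k) (S := k) (A := H) (B := H))
  have := congrArg (fun u : WithConv (H →ₗ[k] H ⊗[k] H) => ofConv (u * convRight k H) h) this
  simp only [one_mul] at this
  rw [mul_assoc, ← convLeft, convLeft_mul_convRight, (ℛ k h).convMul_apply] at this
  exact this

lemma sum_comul_mul_tmul_antipode (h : H) :
    ∑ i ∈ (ℛ k h).index, Δ ((ℛ k h).left i) * ((1 : H) ⊗ₜ[k] 𝑺 ((ℛ k h).right i)) =
      h ⊗ₜ[k] 1 := by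
  have := convMul_comp_antipode
    (Algebra.TensorProduct.includeRight (R := k) (A := H) (B := H))
  have := congrArg (fun u : WithConv (H →ₗ[k] H ⊗[k] H) => ofConv (convLeft k H * u) h) this
  simp only [mul_one] at this
  rw [← mul_assoc, ← convRight, convLeft_mul_convRight, (ℛ k h).convMul_apply] at this
  exact this

lemma sum_lTensor_antipode_comul_mul (h : H) :
    ∑ i ∈ (ℛ k h).index, 𝑺.lTensor H (Δ ((ℛ k h).left i)) * ((1 : H) ⊗ₜ[k] (ℛ k h).right i) =
      h ⊗ₜ[k] 1 := by
  have := comp_antipode_convMul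
    (Algebra.TensorProduct.includeRight (R := k) (A := H) (B := H))
  have := congrArg (fun u : WithConv (H →ₗ[k] H ⊗[k] H) => ofConv (convLeft k H * u) h) this
  simp only [mul_one] at this
  rw [← mul_assoc, (ℛ k h).convMul_apply] at this
  refine Eq.trans (Finset.sum_congr rfl fun i _ => ?_) this
  congr 1
  rw [(ℛ k _).convMul_apply, ← (ℛ k ((ℛ k h).left i)).eq]
  simp [convLeft]

lemma comul_antipode (h : H) :
    Δ (𝑺 h) = ∑ i ∈ (ℛ k h).index, 𝑺 ((ℛ k h).right i) ⊗ₜ[k] 𝑺 ((ℛ k h).left i) := by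
  have h₁ : toConv ((Algebra.TensorProduct.includeRight (R := k) (A := H) (B := H)).toLinearMap
      ∘ₗ 𝑺) * toConv ((Algebra.TensorProduct.includeLeft (R := k) (S := k) (A := H)
      (B := H)).toLinearMap ∘ₗ 𝑺) * toConv Δ = 1 := by
    rw [← convLeft_mul_convRight, mul_assoc, ← mul_assoc _ (convLeft k H) (convRight k H)]
    rw [convLeft, comp_antipode_convMul, one_mul, convRight, comp_antipode_convMul]
  have h₂ := left_inv_eq_right_inv h₁ LinearMap.comul_right_inv
  have h₃ := congrArg (fun u : WithConv (H →ₗ[k] H ⊗[k] H) => ofConv u h) h₂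
  simp only [(ℛ k h).convMul_apply] at h₃
  refine h₃.symm.trans ?_
  simp

/-- The map `t ↦ ∑ (1 ⊗ S b) * t * (a ⊗ 1)` attached to `∑ a ⊗ b`. -/
def antipodeSandwich : H ⊗[k] H →ₗ[k] Module.End k (H ⊗[k] H) :=
  TensorProduct.lift (LinearMap.mk₂ k
    (fun a b => LinearMap.mulLeft k ((1 : H) ⊗ₜ[k] 𝑺 b) ∘ₗ LinearMap.mulRight k (a ⊗ₜ[k] (1 : H)))
    (by intros; ext; simp [mul_add, TensorProduct.add_tmul])
    (by intros; ext; simp [TensorProduct.smul_tmul'])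
    (by intros; ext; simp [add_mul, TensorProduct.tmul_add])
    (by intros; ext; simp))

lemma antipodeSandwich_tmul (a b : H) (t : H ⊗[k] H) :
    antipodeSandwich (a ⊗ₜ[k] b) t = (1 ⊗ₜ[k] 𝑺 b) * (t * (a ⊗ₜ[k] 1)) := rfl

lemma lTensor_antipode_mul (s t : H ⊗[k] H) :
    𝑺.lTensor H (s * t) = antipodeSandwich t (𝑺.lTensor H s) := by
  induction t with
  | zero => simp
  | add a b ha hb => simp [mul_add, ha, hb]
  | tmul a b =>
    rw [antipodeSandwich_tmul]
    induction s with
    | zero => simp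
    | add a b ha hb => simp only [add_mul, map_add, ha, hb, mul_add]
    | tmul c d => simp [HopfAlgebra.antipode_mul_antidistrib]

lemma antipodeSandwich_mul (s t : H ⊗[k] H) (h : H) :
    antipodeSandwich s (t * (1 ⊗ₜ[k] h)) = antipodeSandwich s t * (1 ⊗ₜ[k] h) := by
  induction s with
  | zero => simp
  | add a b ha hb => simp [add_mul, ha, hb]
  | tmul a b => simp [antipodeSandwich_tmul, mul_assoc]

lemma antipodeSandwich_tmul_one (s : H ⊗[k] H) (h : H) :
    antipodeSandwich s (h ⊗ₜ[k] 1) = (h ⊗ₜ[k] 1) * 𝑺.lTensor H s := by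
  induction s with
  | zero => simp
  | add a b ha hb => simp [mul_add, ha, hb]
  | tmul a b => simp [antipodeSandwich_tmul]

/-- A normalized left integral yields a separability tensor. -/
lemma IsLeftIntegral.isSeparabilityTensor {Λ : H} (hΛ : IsLeftIntegral k Λ)
    (h1 : counit (R := k) Λ = 1) : IsSeparabilityTensor (𝑺.lTensor H (Δ Λ)) := by
  constructor
  · rw [HopfAlgebra.mul_antipode_lTensor_comul_apply, h1, map_one]
  · intro h
    rw [← antipodeSandwich_tmul_one, ← sum_lTensor_antipode_comul_mul, map_sum]
    simp only [antipodeSandwich_mul, ← lTensor_antipode_mul, ← Bialgebra.comul_mul, hΛ _]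
    simp only [map_smul, smul_mul_assoc]
    simp only [← mul_smul_comm, ← Finset.mul_sum, ← TensorProduct.tmul_smul,
      ← TensorProduct.tmul_sum, sum_counit_smul]

lemma IsLeftIntegral.isSemisimpleRing {Λ : H} (hΛ : IsLeftIntegral k Λ)
    (h0 : counit (R := k) Λ ≠ 0) : IsSemisimpleRing H := by
  have : IsLeftIntegral k ((counit (R := k) Λ)⁻¹ • Λ) := fun h => by
    rw [mul_smul_comm, hΛ h, smul_comm]
  exact (this.isSeparabilityTensor (by simp [h0])).isSemisimpleRing

lemma exists_mul_eq_smul_of_isSemisimpleRing {A : Type*} [Ring A] [Algebra k A]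
    [IsSemisimpleRing A] (χ : A →ₐ[k] k) :
    ∃ e : A, (∀ a, a * e = χ a • e) ∧ χ e = 1 := by
  obtain ⟨J, hJ⟩ := exists_isCompl (RingHom.ker χ)
  obtain ⟨a, ha, e, he, hae⟩ : ∃ a ∈ RingHom.ker χ, ∃ e ∈ J, a + e = 1 :=
    Submodule.mem_sup.1 (hJ.sup_eq_top ▸ Submodule.mem_top)
  have ha' : χ a = 0 := ha
  refine ⟨e, fun h => ?_, ?_⟩
  · have h₁ : h * e - χ h • e ∈ J :=
      J.sub_mem (J.smul_mem h he) (by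
        rw [Algebra.smul_def]; exact J.smul_mem _ he)
    have h₂ : h * e - χ h • e ∈ RingHom.ker χ := by
      simp [RingHom.mem_ker]
    have h₃ : h * e - χ h • e ∈ RingHom.ker χ ⊓ J := ⟨h₂, h₁⟩
    rw [hJ.inf_eq_bot] at h₃
    exact sub_eq_zero.1 h₃
  · have := congrArg χ hae
    simpa [ha'] using this

lemma exists_isLeftIntegral [IsSemisimpleRing H] :
    ∃ Λ : H, IsLeftIntegral k Λ ∧ counit (R := k) Λ = 1 :=
  exists_mul_eq_smul_of_isSemisimpleRing (Bialgebra.counitAlgHom k H)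

lemma exists_isRightIntegral [IsSemisimpleRing H] :
    ∃ Λ : H, IsRightIntegral k Λ ∧ counit (R := k) Λ = 1 := by
  obtain ⟨e, he, h1⟩ := exists_mul_eq_smul_of_isSemisimpleRing
    ((Bialgebra.counitAlgHom k H).fromOpposite fun _ _ => Commute.all _ _)
  exact ⟨e.unop, fun h => congrArg MulOpposite.unop (he (MulOpposite.op h)), h1⟩

lemma exists_isLeftIntegral_isRightIntegral [IsSemisimpleRing H] :
    ∃ Λ : H, IsLeftIntegral k Λ ∧ IsRightIntegral k Λ ∧ counit (R := k) Λ = 1 := by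
  obtain ⟨Λ, hl, h1⟩ := exists_isLeftIntegral (k := k) (H := H)
  obtain ⟨Λ', hr, h1'⟩ := exists_isRightIntegral (k := k) (H := H)
  have : Λ = Λ' := by
    have h₁ := hl Λ'
    rw [hr Λ, h1, h1', one_smul, one_smul] at h₁
    exact h₁.symm
  exact ⟨Λ, hl, this ▸ hr, h1⟩

end Integrals

section TraceIntegral
variable {k H : Type*} [Field k] [Ring H] [HopfAlgebra k H]

local notation "𝑺" => HopfAlgebra.antipode k (A := H)
local notation "Δ" => comul (R := k) (A := H)

lemma sum_tmul_mul_rTensor_antipode_comul (h : H) :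
    ∑ i ∈ (ℛ k h).index, ((ℛ k h).left i ⊗ₜ[k] (1 : H)) * 𝑺.rTensor H (Δ ((ℛ k h).right i)) =
      1 ⊗ₜ[k] h := by
  have := convMul_comp_antipode
    (Algebra.TensorProduct.includeLeft (R := k) (S := k) (A := H) (B := H))
  have := congrArg (fun u : WithConv (H →ₗ[k] H ⊗[k] H) =>
    WithConv.ofConv (u * convRight k H) h) this
  simp only [one_mul] at this
  rw [mul_assoc, (ℛ k h).convMul_apply] at this
  refine Eq.trans (Finset.sum_congr rfl fun i _ => ?_) this
  congr 1
  rw [(ℛ k _).convMul_apply, ← (ℛ k ((ℛ k h).right i)).eq]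
  simp [convRight]

variable (k H) in
/-- The square of the antipode. -/
def antipodeSq : H →ₐ[k] H :=
  AlgHom.ofLinearMap (𝑺 ∘ₗ 𝑺) (by simp) (by simp [HopfAlgebra.antipode_mul_antidistrib])

lemma antipodeSq_apply (h : H) : antipodeSq k H h = 𝑺 (𝑺 h) := rfl

lemma toLinearMap_antipodeSq : (antipodeSq k H).toLinearMap = 𝑺 ∘ₗ 𝑺 := rfl

@[simp] lemma counit_antipodeSq (h : H) :
    counit (R := k) (antipodeSq k H h) = counit (R := k) h := by
  simp [antipodeSq_apply]

lemma comul_antipode_eq_comm (h : H) :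
    Δ (𝑺 h) = TensorProduct.comm k H H (TensorProduct.map 𝑺 𝑺 (Δ h)) := by
  rw [comul_antipode]
  conv_rhs => rw [← (ℛ k h).eq]
  simp

lemma comul_antipodeSq (h : H) :
    Δ (antipodeSq k H h) =
      TensorProduct.map (antipodeSq k H).toLinearMap (antipodeSq k H).toLinearMap (Δ h) := by
  rw [antipodeSq_apply, comul_antipode_eq_comm, comul_antipode_eq_comm, ← (ℛ k h).eq]
  simp [antipodeSq_apply]

lemma sum_comul_antipodeSq_mul (a : H) :
    ∑ i ∈ (ℛ k a).index,
      Δ (antipodeSq k H ((ℛ k a).right i)) * (𝑺 ((ℛ k a).left i) ⊗ₜ[k] 1) =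
        1 ⊗ₜ[k] antipodeSq k H a := by
  have key : ∀ (c : H) (t : H ⊗[k] H),
      TensorProduct.map (antipodeSq k H).toLinearMap (antipodeSq k H).toLinearMap t *
        (𝑺 c ⊗ₜ[k] 1) =
      TensorProduct.map 𝑺 (antipodeSq k H).toLinearMap ((c ⊗ₜ[k] 1) * 𝑺.rTensor H t) := by
    intro c t
    induction t with
    | zero => simp
    | tmul x y => simp [antipodeSq_apply, HopfAlgebra.antipode_mul_antidistrib]
    | add x y hx hy => simp only [map_add, add_mul, mul_add, hx, hy]
  simp only [comul_antipodeSq, key, ← map_sum]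
  rw [sum_tmul_mul_rTensor_antipode_comul]
  simp

/-- Contraction of the first tensor factor with a linear form. -/
def contractFst (p : Module.Dual k H) : H ⊗[k] H →ₗ[k] H :=
  TensorProduct.lift (LinearMap.lsmul k H ∘ₗ p)

@[simp] lemma contractFst_tmul (p : Module.Dual k H) (a b : H) :
    contractFst p (a ⊗ₜ[k] b) = p a • b := rfl

/-- The action of linear forms on the Hopf algebra, `a ↦ ∑ p a₁ • a₂`. -/
def leftHit (p : Module.Dual k H) : Module.End k H := contractFst p ∘ₗ Δ

lemma leftHit_apply {ι : Type*} (p : Module.Dual k H) {a : H} (r : Coalgebra.Repr k a ι) :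
    leftHit p a = ∑ i ∈ r.index, p (r.left i) • r.right i := by
  simp [leftHit, ← r.eq]

lemma contractFst_mul_tmul_one (p : Module.Dual k H) (c : H) (t : H ⊗[k] H) :
    contractFst p (t * (c ⊗ₜ[k] 1)) = contractFst (p ∘ₗ LinearMap.mulRight k c) t := by
  induction t with
  | zero => simp
  | tmul x y => simp
  | add x y hx hy => simp only [map_add, add_mul, hx, hy]

lemma contractFst_mul_one_tmul (p : Module.Dual k H) (c : H) (t : H ⊗[k] H) :
    contractFst p (t * (1 ⊗ₜ[k] c)) = contractFst p t * c := by
  induction t with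
  | zero => simp
  | tmul x y => simp
  | add x y hx hy => simp only [map_add, add_mul, hx, hy]

lemma contractFst_tmul_one_mul_rTensor (p : Module.Dual k H) (c : H) (f : H →ₗ[k] H)
    (t : H ⊗[k] H) :
    contractFst p ((c ⊗ₜ[k] 1) * f.rTensor H t) =
      contractFst (p ∘ₗ LinearMap.mulLeft k c ∘ₗ f) t := by
  induction t with
  | zero => simp
  | tmul x y => simp
  | add x y hx hy => simp only [map_add, mul_add, hx, hy]

/-- The linear form `h ↦ tr (L_h ∘ S²)`. -/
def traceForm (k H : Type*) [Field k] [Ring H] [HopfAlgebra k H] : Module.Dual k H :=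
  LinearMap.trace k H ∘ₗ (LinearMap.mulRight k (antipodeSq k H).toLinearMap :
    Module.End k H →ₗ[k] Module.End k H) ∘ₗ (Algebra.lmul k H).toLinearMap

lemma traceForm_apply (h : H) : traceForm k H h =
    LinearMap.trace k H (LinearMap.mulLeft k h ∘ₗ (antipodeSq k H).toLinearMap) := rfl

variable [FiniteDimensional k H]

lemma sum_coord_smul_contractFst (f : H →ₗ[k] Module.Dual k H) (c : H) (t : H ⊗[k] H) :
    ∑ j, (Module.finBasis k H).coord j c • contractFst (f (Module.finBasis k H j)) t =
      contractFst (f c) t := by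
  have h : f c = ∑ j, (Module.finBasis k H).coord j c • f (Module.finBasis k H j) := by
    simpa only [map_sum, map_smul, Module.Basis.coord_apply] using
        (congrArg f ((Module.finBasis k H).sum_repr c)).symm
  induction t with
  | zero => simp
  | tmul x y => simp [h, Finset.sum_smul, smul_smul]
  | add x y hx hy => simp only [map_add, smul_add, Finset.sum_add_distrib, hx, hy]

lemma sum_apply_smul_contractFst_coord (g : Module.Dual k H) (t : H ⊗[k] H) :
    ∑ j, g (Module.finBasis k H j) • contractFst ((Module.finBasis k H).coord j) t =
      contractFst g t := by
  induction t with
  | zero => simp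
  | tmul x y =>
    have h : g x = ∑ j, (Module.finBasis k H).coord j x • g (Module.finBasis k H j) := by
      simpa only [map_sum, map_smul, Module.Basis.coord_apply] using
        (congrArg g ((Module.finBasis k H).sum_repr x)).symm
    simp [h, Finset.sum_smul, smul_smul, mul_comm]
  | add x y hx hy => simp only [map_add, smul_add, Finset.sum_add_distrib, hx, hy]

lemma traceForm_leftHit (p : Module.Dual k H) (h : H) :
    traceForm k H (leftHit p h) = p 1 * traceForm k H h := by
  let b := Module.finBasis k H
  let q : H →ₗ[k] Module.Dual k H :=
    (LinearMap.llcomp k H H k p) ∘ₗ (LinearMap.mul k H).flip ∘ₗ 𝑺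
  have hq : ∀ c x, q c x = p (x * 𝑺 c) := fun _ _ => rfl
  let g : Module.End k H := LinearMap.mulLeft k h ∘ₗ (antipodeSq k H).toLinearMap
  have h₁ : LinearMap.mulLeft k (leftHit p h) ∘ₗ (antipodeSq k H).toLinearMap =
      ∑ j, leftHit (q (b j)) * (g * leftHit (b.coord j)) := by
    ext a
    have e₁ := congrArg (fun t => contractFst p (Δ h * t)) (sum_comul_antipodeSq_mul (k := k) a)
    simp only [Finset.mul_sum, map_sum, contractFst_mul_one_tmul, ← mul_assoc,
      ← Bialgebra.comul_mul, contractFst_mul_tmul_one] at e₁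
    simp only [LinearMap.sum_apply, Module.End.mul_apply, leftHit_apply _ (ℛ k a), map_sum,
      map_smul]
    rw [Finset.sum_comm]
    refine e₁.symm.trans (Finset.sum_congr rfl fun i _ => ?_)
    exact (sum_coord_smul_contractFst q _ _).symm
  have h₂ : ∑ j, leftHit (b.coord j) * leftHit (q (b j)) = p 1 • (1 : Module.End k H) := by
    ext a
    have e₁ := congrArg (contractFst p) (sum_tmul_mul_rTensor_antipode_comul (k := k) a)
    simp only [map_sum, contractFst_tmul_one_mul_rTensor, contractFst_tmul] at e₁
    simp only [LinearMap.sum_apply, Module.End.mul_apply, leftHit_apply (q _) (ℛ k a), map_sum,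
      map_smul, LinearMap.smul_apply, Module.End.one_apply]
    rw [Finset.sum_comm]
    refine Eq.trans (Finset.sum_congr rfl fun i _ => ?_) e₁
    exact sum_apply_smul_contractFst_coord (p ∘ₗ LinearMap.mulLeft k ((ℛ k a).left i) ∘ₗ 𝑺) _
  rw [traceForm_apply, h₁, map_sum]
  simp only [LinearMap.trace_mul_comm, mul_assoc]
  simp only [← map_sum, ← Finset.mul_sum, h₂]
  simp [traceForm_apply, g]

end TraceIntegral

section Radford
variable {k H : Type*} [Field k] [Ring H] [HopfAlgebra k H]

local notation "𝑺" => HopfAlgebra.antipode k (A := H)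
local notation "Δ" => comul (R := k) (A := H)

lemma contractFst_tmul_one_mul (p : Module.Dual k H) (c : H) (t : H ⊗[k] H) :
    contractFst p ((c ⊗ₜ[k] 1) * t) = contractFst (p ∘ₗ LinearMap.mulLeft k c) t := by
  simpa using contractFst_tmul_one_mul_rTensor p c LinearMap.id t

lemma contractFst_one_tmul_mul (p : Module.Dual k H) (c : H) (t : H ⊗[k] H) :
    contractFst p ((1 ⊗ₜ[k] c) * t) = c * contractFst p t := by
  induction t with
  | zero => simp
  | tmul x y => simp
  | add x y hx hy => simp only [map_add, mul_add, hx, hy]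

/-- Contraction of the second tensor factor with a linear form. -/
def contractSnd (p : Module.Dual k H) : H ⊗[k] H →ₗ[k] H :=
  contractFst p ∘ₗ (TensorProduct.comm k H H).toLinearMap

@[simp] lemma contractSnd_tmul (p : Module.Dual k H) (a b : H) :
    contractSnd p (a ⊗ₜ[k] b) = p b • a := rfl

lemma contractSnd_mul_tmul_one (p : Module.Dual k H) (c : H) (t : H ⊗[k] H) :
    contractSnd p (t * (c ⊗ₜ[k] 1)) = contractSnd p t * c := by
  induction t with
  | zero => simp
  | tmul x y => simp
  | add x y hx hy => simp only [map_add, add_mul, hx, hy]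

lemma contractSnd_mul_one_tmul (p : Module.Dual k H) (c : H) (t : H ⊗[k] H) :
    contractSnd p (t * (1 ⊗ₜ[k] c)) = contractSnd (p ∘ₗ LinearMap.mulRight k c) t := by
  induction t with
  | zero => simp
  | tmul x y => simp
  | add x y hx hy => simp only [map_add, add_mul, hx, hy]

/-- The action of linear forms on the Hopf algebra, `a ↦ ∑ p a₂ • a₁`. -/
def rightHit (p : Module.Dual k H) : Module.End k H := contractSnd p ∘ₗ Δ

lemma rightHit_apply {ι : Type*} (p : Module.Dual k H) {a : H} (r : Coalgebra.Repr k a ι) :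
    rightHit p a = ∑ i ∈ r.index, p (r.right i) • r.left i := by
  simp [rightHit, ← r.eq]

lemma apply_rightHit (p q : Module.Dual k H) (a : H) : p (rightHit q a) = q (leftHit p a) := by
  simp [rightHit_apply q (ℛ k a), leftHit_apply p (ℛ k a), mul_comm]

lemma comul_leftHit (p : Module.Dual k H) (a : H) :
    Δ (leftHit p a) = (leftHit p).rTensor H (Δ a) := by
  have h : ∀ t : H ⊗[k] H, Δ (contractFst p t) =
      TensorProduct.lift (LinearMap.lsmul k (H ⊗[k] H) ∘ₗ p) (comul.lTensor H t) := by
    intro t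
    induction t with
    | zero => simp
    | tmul x y => simp
    | add x y hx hy => simp only [map_add, hx, hy]
  have h' : TensorProduct.lift (LinearMap.lsmul k (H ⊗[k] H) ∘ₗ p) ∘ₗ
      (TensorProduct.assoc k H H H).toLinearMap = (contractFst p).rTensor H := by
    ext x y z
    simp [smul_tmul']
  rw [leftHit, LinearMap.comp_apply, h, ← coassoc_apply, LinearMap.rTensor_comp]
  exact LinearMap.congr_fun h' _

lemma comul_rightHit (p : Module.Dual k H) (a : H) :
    Δ (rightHit p a) = (rightHit p).lTensor H (Δ a) := by
  have h : ∀ t : H ⊗[k] H, Δ (contractSnd p t) =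
      TensorProduct.lift ((LinearMap.lsmul k (H ⊗[k] H) ∘ₗ p).flip) (comul.rTensor H t) := by
    intro t
    induction t with
    | zero => simp
    | tmul x y => simp
    | add x y hx hy => simp only [map_add, hx, hy]
  have h' : TensorProduct.lift ((LinearMap.lsmul k (H ⊗[k] H) ∘ₗ p).flip) ∘ₗ
      (TensorProduct.assoc k H H H).symm.toLinearMap = (contractSnd p).lTensor H := by
    ext x y z
    simp
  rw [rightHit, LinearMap.comp_apply, h, ← coassoc_symm_apply, LinearMap.lTensor_comp]
  exact LinearMap.congr_fun h' _

lemma counit_leftHit (p : Module.Dual k H) (a : H) :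
    counit (R := k) (leftHit p a) = p a := by
  have h : ∀ t : H ⊗[k] H, counit (R := k) (contractFst p t) =
      p (TensorProduct.rid k H (counit.lTensor H t)) := by
    intro t
    induction t with
    | zero => simp
    | tmul x y => simp [mul_comm]
    | add x y hx hy => simp only [map_add, hx, hy]
  simp [leftHit, h]

lemma rightHit_comp_leftHit (p q : Module.Dual k H) (a : H) :
    rightHit (q ∘ₗ leftHit p) a = rightHit p (rightHit q a) := by
  have h : ∀ t : H ⊗[k] H, contractSnd p ((rightHit q).lTensor H t) =
      contractSnd (p ∘ₗ rightHit q) t := by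
    intro t
    induction t with
    | zero => simp
    | tmul x y => simp
    | add x y hx hy => simp only [map_add, hx, hy]
  have h' : q ∘ₗ leftHit p = p ∘ₗ rightHit q := LinearMap.ext fun x => (apply_rightHit _ _ _).symm
  rw [h', rightHit, LinearMap.comp_apply, ← h, ← comul_rightHit]
  rfl

lemma sum_counit_right_smul {ι : Type*} {a : H} (r : Coalgebra.Repr k a ι) :
    ∑ i ∈ r.index, counit (R := k) (r.right i) • r.left i = a := by
  simpa only [map_sum, TensorProduct.rid_tmul, one_smul] using
    congrArg (TensorProduct.rid k H) (sum_tmul_counit_eq r)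

lemma IsLeftIntegral.one_tmul_mul_comul {Λ : H} (hΛ : IsLeftIntegral k Λ) (h : H) :
    (1 ⊗ₜ[k] h) * Δ Λ = (𝑺 h ⊗ₜ[k] 1) * Δ Λ := by
  rw [← sum_antipode_tmul_mul_comul, Finset.sum_mul]
  simp only [mul_assoc, ← Bialgebra.comul_mul, hΛ _, map_smul, mul_smul_comm]
  conv_rhs => rw [← sum_counit_right_smul (ℛ k h)]
  simp [sum_tmul, Finset.sum_mul, ← smul_tmul']

lemma IsRightIntegral.comul_mul_tmul_one {Λ : H} (hΛ : IsRightIntegral k Λ) (h : H) :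
    Δ Λ * (h ⊗ₜ[k] 1) = Δ Λ * (1 ⊗ₜ[k] 𝑺 h) := by
  rw [← sum_comul_mul_tmul_antipode, Finset.mul_sum]
  simp only [← mul_assoc, ← Bialgebra.comul_mul, hΛ _, map_smul, smul_mul_assoc]
  conv_rhs => rw [← sum_counit_smul (ℛ k h)]
  simp [tmul_sum, Finset.mul_sum, tmul_smul]

lemma traceForm_mul_comm (x y : H) :
    traceForm k H (x * y) = traceForm k H (y * antipodeSq k H x) := by
  rw [traceForm_apply, traceForm_apply]
  have h₁ : LinearMap.mulLeft k (x * y) ∘ₗ (antipodeSq k H).toLinearMap =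
    (LinearMap.mulLeft k x : Module.End k H) * (LinearMap.mulLeft k y ∘ₗ
      (antipodeSq k H).toLinearMap) := by ext; simp
  have h₂ : LinearMap.mulLeft k (y * antipodeSq k H x) ∘ₗ (antipodeSq k H).toLinearMap =
    (LinearMap.mulLeft k y ∘ₗ (antipodeSq k H).toLinearMap) *
      (LinearMap.mulLeft k x : Module.End k H) := by ext; simp
  rw [h₁, h₂, LinearMap.trace_mul_comm]

lemma traceForm_one : traceForm k H 1 = LinearMap.trace k H (𝑺 ∘ₗ 𝑺) := by
  rw [traceForm_apply, toLinearMap_antipodeSq]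
  congr 1
  ext; simp

lemma leftHit_traceForm_mul {Λ : H} (hr : IsRightIntegral k Λ) (hl : IsLeftIntegral k Λ) (h : H) :
    leftHit (traceForm k H) Λ * antipodeSq k H (antipodeSq k H h) =
      h * leftHit (traceForm k H) Λ := by
  have h₁ := congrArg (contractFst (traceForm k H))
    (hr.comul_mul_tmul_one (antipodeSq k H (𝑺 h)))
  rw [contractFst_mul_one_tmul, contractFst_mul_tmul_one] at h₁
  have h₂ := congrArg (contractFst (traceForm k H)) (hl.one_tmul_mul_comul h)
  rw [contractFst_one_tmul_mul, contractFst_tmul_one_mul] at h₂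
  have h₃ : traceForm k H ∘ₗ LinearMap.mulRight k (antipodeSq k H (𝑺 h)) =
      traceForm k H ∘ₗ LinearMap.mulLeft k (𝑺 h) := by
    ext x
    exact (traceForm_mul_comm _ _).symm
  rw [h₃] at h₁
  exact (h₂.trans h₁).symm

variable [FiniteDimensional k H]

lemma IsRightIntegral.traceForm_eq {Λ : H} (hΛ : IsRightIntegral k Λ) :
    traceForm k H Λ = counit (R := k) Λ := by
  have : LinearMap.mulLeft k Λ ∘ₗ (antipodeSq k H).toLinearMap =
      (counit (R := k) (A := H)).smulRight Λ := by
    ext a; simp [hΛ _]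
  rw [traceForm_apply, this, LinearMap.trace_smulRight]

lemma rightHit_traceForm (h : H) : rightHit (traceForm k H) h = traceForm k H h • 1 := by
  refine (Module.forall_dual_apply_eq_zero_iff k _).mp ?_ |> sub_eq_zero.mp
  intro p
  rw [map_sub, apply_rightHit, traceForm_leftHit]
  simp [mul_comm]

section
variable {Λ : H}

lemma contractSnd_comul_injective
    (hr : IsRightIntegral k Λ) (h1 : counit (R := k) Λ = 1) :
    Function.Injective fun p : Module.Dual k H => rightHit p Λ := by
  have hs : Function.Surjective fun p : Module.Dual k H => rightHit p Λ := by
    intro h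
    refine ⟨traceForm k H ∘ₗ LinearMap.mulRight k (𝑺 h), ?_⟩
    simp only [rightHit, LinearMap.comp_apply]
    rw [← contractSnd_mul_one_tmul, ← hr.comul_mul_tmul_one, contractSnd_mul_tmul_one]
    change rightHit _ Λ * h = h
    rw [rightHit_traceForm, hr.traceForm_eq, h1]
    simp
  let θ : Module.Dual k H →ₗ[k] H :=
    { toFun := fun p => rightHit p Λ
      map_add' := fun p q => by
        simp only [rightHit_apply _ (ℛ k Λ), LinearMap.add_apply, add_smul,
          Finset.sum_add_distrib]
      map_smul' := fun c q => by
        simp only [rightHit_apply _ (ℛ k Λ), LinearMap.smul_apply, smul_assoc,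
          Finset.smul_sum, RingHom.id_apply] }
  exact (LinearMap.injective_iff_surjective_of_finrank_eq_finrank (f := θ)
    Subspace.dual_finrank_eq).mpr hs

lemma eq_smul_traceForm (hr : IsRightIntegral k Λ) (h1 : counit (R := k) Λ = 1)
    {q : Module.Dual k H} (hq : ∀ h, rightHit q h = q h • 1) :
    q = q Λ • traceForm k H := by
  apply contractSnd_comul_injective hr h1
  have : rightHit (q Λ • traceForm k H) Λ = q Λ • rightHit (traceForm k H) Λ := by
    simp only [rightHit_apply _ (ℛ k Λ), LinearMap.smul_apply, smul_assoc,
          Finset.smul_sum]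
  simp only [this, hq, rightHit_traceForm, hr.traceForm_eq, h1, one_smul]

lemma leftHit_traceForm
    (hr : IsRightIntegral k Λ) (h1 : counit (R := k) Λ = 1) (h : H) :
    leftHit (traceForm k H) h = traceForm k H h • leftHit (traceForm k H) Λ := by
  refine (Module.forall_dual_apply_eq_zero_iff k _).mp ?_ |> sub_eq_zero.mp
  intro p
  have := eq_smul_traceForm hr h1 (q := p ∘ₗ leftHit (traceForm k H)) fun h => by
    rw [rightHit_comp_leftHit, rightHit_traceForm, apply_rightHit]
    rfl
  have := LinearMap.congr_fun this h
  simp only [LinearMap.comp_apply, LinearMap.smul_apply, smul_eq_mul] at this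
  rw [map_sub, this, map_smul, smul_eq_mul, mul_comm, sub_self]

lemma isGroupLikeElem_leftHit_traceForm
    (hr : IsRightIntegral k Λ) (h1 : counit (R := k) Λ = 1) :
    IsGroupLikeElem k (leftHit (traceForm k H) Λ) where
  counit_eq_one := by rw [counit_leftHit, hr.traceForm_eq, h1]
  comul_eq_tmul_self := by
    have h : ∀ t : H ⊗[k] H, (leftHit (traceForm k H)).rTensor H t =
        leftHit (traceForm k H) Λ ⊗ₜ[k] contractFst (traceForm k H) t := by
      intro t
      induction t with
      | zero => simp
      | tmul x y =>
        rw [LinearMap.rTensor_tmul, leftHit_traceForm hr h1 x]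
        simp [smul_tmul]
      | add x y hx hy => simp only [map_add, hx, hy, tmul_add]
    rw [comul_leftHit, h]
    rfl

/-- Radford: the square of the antipode has finite order. -/
lemma exists_antipodeSq_pow_eq_one
    (hr : IsRightIntegral k Λ) (hl : IsLeftIntegral k Λ) (h1 : counit (R := k) Λ = 1) :
    ∃ N, 0 < N ∧ (antipodeSq k H) ^ N = 1 := by
  have : Finite (GroupLike k H) := (linearIndep_groupLikeVal (R := k) (A := H)).finite
  let g : GroupLike k H := ⟨_, isGroupLikeElem_leftHit_traceForm hr h1⟩
  have hg : ∀ m (h : H), g.val ^ m * ((antipodeSq k H) ^ (2 * m)) h = h * g.val ^ m := by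
    intro m
    induction m with
    | zero => intro h; simp
    | succ m ih =>
      intro h
      have e : ((antipodeSq k H) ^ (2 * (m + 1))) h =
          ((antipodeSq k H) ^ (2 * m)) (antipodeSq k H (antipodeSq k H h)) := by
        rw [mul_add, mul_one, pow_add, AlgHom.mul_apply, sq, AlgHom.mul_apply]
      rw [e, pow_succ', mul_assoc, ih, ← mul_assoc, leftHit_traceForm_mul hr hl h, mul_assoc]
  obtain ⟨N, hN, hgN⟩ := isOfFinOrder_iff_pow_eq_one.mp (isOfFinOrder_of_finite g)
  refine ⟨2 * N, by omega, ?_⟩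
  ext h
  have hgN' : g.val ^ N = 1 := by rw [← GroupLike.val_pow, hgN, GroupLike.val_one]
  simpa [hgN'] using hg N h

lemma antipodeSq_antipodeSq
    (hr : IsRightIntegral k Λ) (hl : IsLeftIntegral k Λ) (h1 : counit (R := k) Λ = 1)
    (h0 : LinearMap.trace k H (𝑺 ∘ₗ 𝑺) ≠ 0) (h : H) :
    antipodeSq k H (antipodeSq k H h) = h := by
  have hg : leftHit (traceForm k H) Λ = 1 := by
    have := leftHit_traceForm hr h1 1
    rw [traceForm_one] at this
    have h' : leftHit (traceForm k H) 1 = traceForm k H 1 • (1 : H) := by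
      simp [leftHit, Algebra.TensorProduct.one_def]
    rw [h', traceForm_one] at this
    exact (smul_right_injective H h0 this).symm
  simpa [hg] using leftHit_traceForm_mul hr hl h

end
end Radford

section RootsOfUnity
variable {K : Type*} [Field K] [CharZero K]

/-- Pairs of algebraic numbers that become complex conjugate under a fixed embedding into `ℂ`. -/
def conjPairs (σ : algebraicClosure ℚ K →ₐ[ℚ] ℂ) : AddSubmonoid (K × K) where
  carrier := {p | ∃ x y : algebraicClosure ℚ K, (x : K) = p.1 ∧ (y : K) = p.2 ∧
    σ y = starRingEnd ℂ (σ x)}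
  zero_mem' := ⟨0, 0, by simp⟩
  add_mem' := by
    rintro p q ⟨x, y, hx, hy, h⟩ ⟨x', y', hx', hy', h'⟩
    exact ⟨x + x', y + y', by simp [hx, hx'], by simp [hy, hy'], by simp [h, h']⟩

variable {σ : algebraicClosure ℚ K →ₐ[ℚ] ℂ}

lemma mem_conjPairs_of_pow_eq_one {N : ℕ} (hN : 0 < N) {μ : K} (hμ : μ ^ N = 1) :
    (μ, μ⁻¹) ∈ conjPairs σ := by
  have hmem : μ ∈ algebraicClosure ℚ K := by
    rw [mem_algebraicClosure_iff']
    refine IsIntegral.of_pow hN ?_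
    rw [hμ]
    exact isIntegral_one
  let x : algebraicClosure ℚ K := ⟨μ, hmem⟩
  have hx : x ^ N = 1 := Subtype.ext hμ
  have hσ : ‖σ x‖ = 1 := Complex.norm_eq_one_of_pow_eq_one (by rw [← map_pow, hx, map_one]) hN.ne'
  refine ⟨x, x⁻¹, rfl, rfl, ?_⟩
  rw [map_inv₀, Complex.inv_def, Complex.normSq_eq_norm_sq, hσ]
  simp

lemma eq_zero_of_sum_mul_eq_zero {ι : Type*} (s : Finset ι) {x y : ι → K}
    (h : ∀ i ∈ s, (x i, y i) ∈ conjPairs σ) (h0 : ∑ i ∈ s, x i * y i = 0) :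
    ∀ i ∈ s, y i = 0 := by
  have : ∀ i : s, ∃ a b : algebraicClosure ℚ K, (a : K) = x i ∧ (b : K) = y i ∧
    σ b = starRingEnd ℂ (σ a) := fun i => h i i.2
  choose a b ha hb hσ using this
  have h1 : ∑ i : s, a i * b i = 0 := by
    apply Subtype.ext
    have e : ∀ i : s, ((a i * b i : algebraicClosure ℚ K) : K) = x i * y i := fun i => by
      simp [ha, hb]
    simp only [AddSubmonoidClass.coe_finsetSum, e, ZeroMemClass.coe_zero]
    rwa [Finset.sum_coe_sort s (fun i => x i * y i)]
  have h2 := congrArg σ h1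
  simp only [map_sum, map_mul, hσ, Complex.mul_conj, map_zero] at h2
  rw [← Complex.ofReal_sum] at h2
  have h3 := (Finset.sum_eq_zero_iff_of_nonneg fun i _ => Complex.normSq_nonneg _).mp
    (Complex.ofReal_eq_zero.mp h2)
  intro i hi
  have h4 : σ (b ⟨i, hi⟩) = 0 := by
    rw [hσ, Complex.normSq_eq_zero.mp (h3 ⟨i, hi⟩ (Finset.mem_univ _)), map_zero]
  rw [← hb ⟨i, hi⟩, (map_eq_zero σ).mp h4, ZeroMemClass.coe_zero]

end RootsOfUnity

section Trace
lemma trace_eq_of_intertwining {K M N : Type*} [Field K] [AddCommGroup M] [Module K M]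
    [AddCommGroup N] [Module K N] (e : M ≃ₗ[K] N) (f : Module.End K M) (g : Module.End K N)
    (h : ∀ x, g (e x) = e (f x)) : LinearMap.trace K N g = LinearMap.trace K M f := by
  have : g = e.conj f := by
    ext x
    rw [LinearEquiv.conj_apply_apply, ← h, e.apply_symm_apply]
  rw [this, LinearMap.trace_conj']

variable {K V : Type*} [Field K] [AddCommGroup V] [Module K V] [FiniteDimensional K V]

lemma trace_mulLeft_comp_mulRight (a b : Module.End K V) :
    LinearMap.trace K (Module.End K V) (LinearMap.mulLeft K a ∘ₗ LinearMap.mulRight K b) =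
      LinearMap.trace K V a * LinearMap.trace K V b := by
  have h : ∀ t, (LinearMap.mulLeft K a ∘ₗ LinearMap.mulRight K b : Module.End K (Module.End K V))
      (dualTensorHomEquiv K V V t) =
      dualTensorHomEquiv K V V (TensorProduct.map (Module.Dual.transpose b) a t) := by
    intro t
    induction t with
    | zero => simp
    | tmul f v => ext w; simp [Module.Dual.transpose]
    | add x y hx hy => simp only [map_add, hx, hy]
  have := trace_eq_of_intertwining (M := Module.Dual K V ⊗[K] V) (N := Module.End K V)
    (dualTensorHomEquiv K V V) _ _ h
  rw [this, LinearMap.trace_tensorProduct', LinearMap.trace_transpose', mul_comm]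

lemma trace_mem_conjPairs [IsAlgClosed K] [CharZero K] (σ : algebraicClosure ℚ K →ₐ[ℚ] ℂ)
    {N : ℕ} (hN : 0 < N) {u v : Module.End K V} (hu : u ^ N = 1) (hvu : v * u = 1) :
    (LinearMap.trace K V u, LinearMap.trace K V v) ∈ conjPairs σ := by
  classical
  have hss : u.IsSemisimple := by
    refine Module.End.isSemisimple_of_squarefree_aeval_eq_zero (p := Polynomial.X ^ N - 1) ?_ ?_
    · exact (Polynomial.X_pow_sub_one_separable_iff.mpr (by exact_mod_cast hN.ne')).squarefree
    · simp [hu]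
  have hsup : ⨆ μ, u.eigenspace μ = ⊤ := by
    rw [← Module.End.iSup_maxGenEigenspace_eq_top u]
    exact iSup_congr fun μ => (hss.isFinitelySemisimple.maxGenEigenspace_eq_eigenspace μ).symm
  have hinternal : DirectSum.IsInternal fun μ => u.eigenspace μ :=
    DirectSum.isInternal_submodule_of_iSupIndep_of_iSup_eq_top u.eigenspaces_iSupIndep hsup
  have hfin : {μ | u.eigenspace μ ≠ ⊥}.Finite :=
    WellFoundedGT.finite_ne_bot_of_iSupIndep u.eigenspaces_iSupIndep
  have hpow : ∀ μ, u.eigenspace μ ≠ ⊥ → μ ^ N = 1 := by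
    intro μ hμ
    obtain ⟨x, hx, hx0⟩ := Submodule.exists_mem_ne_zero_of_ne_bot hμ
    have : (u ^ N) x = μ ^ N • x :=
      Module.End.HasEigenvector.pow_apply ⟨hx, hx0⟩ N
    rw [hu, Module.End.one_apply] at this
    exact (smul_left_injective K hx0 (by simpa using this)).symm
  have hvμ : ∀ μ, ∀ x ∈ u.eigenspace μ, v x = μ⁻¹ • x := by
    intro μ x hx
    by_cases hx0 : x = 0
    · simp [hx0]
    have hμ0 : μ ≠ 0 := by
      rintro rfl
      have := hpow 0 (Submodule.ne_bot_iff _ |>.mpr ⟨x, hx, hx0⟩)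
      simp [hN.ne'] at this
    have := LinearMap.congr_fun hvu x
    rw [Module.End.mul_apply, Module.End.mem_eigenspace_iff.mp hx, map_smul] at this
    rw [eq_inv_smul_iff₀ hμ0, this, Module.End.one_apply]
  have htr : ∀ (w : Module.End K V) (c : K → K), (∀ μ, ∀ x ∈ u.eigenspace μ, w x = c μ • x) →
      LinearMap.trace K V w =
        ∑ μ ∈ hfin.toFinset, Module.finrank K (u.eigenspace μ) • c μ := by
    intro w c hw
    have hmaps : ∀ μ, Set.MapsTo w (u.eigenspace μ) (u.eigenspace μ) := fun μ x hx => by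
      rw [hw μ x hx]; exact Submodule.smul_mem _ _ hx
    rw [LinearMap.trace_eq_sum_trace_restrict' hinternal hfin hmaps]
    refine Finset.sum_congr rfl fun μ _ => ?_
    have : w.restrict (hmaps μ) = c μ • LinearMap.id :=
      LinearMap.ext fun x => Subtype.ext (hw μ x x.2)
    rw [this, map_smul, LinearMap.trace_id, nsmul_eq_mul, smul_eq_mul, mul_comm]
  rw [htr u id fun μ x hx => Module.End.mem_eigenspace_iff.mp hx, htr v _ hvμ]
  have := sum_mem (S := conjPairs σ) (t := hfin.toFinset)
    (f := fun μ => Module.finrank K (u.eigenspace μ) • (μ, μ⁻¹)) fun μ hμ =>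
      nsmul_mem (mem_conjPairs_of_pow_eq_one hN (hpow μ (by simpa using hμ))) _
  convert this using 1
  ext <;> simp [Prod.fst_sum, Prod.snd_sum]

end Trace

section Automorphism
variable {K V : Type*} [Field K] [AddCommGroup V] [Module K V] [FiniteDimensional K V]

/-- An automorphism of finite order of a matrix algebra is conjugation by an element of the same
order. -/
lemma exists_conj_pow_eq_one [IsAlgClosed K] {N : ℕ} (hN : 0 < N)
    (φ : Module.End K V →ₐ[K] Module.End K V) (hφ : φ ^ N = 1) :
    ∃ u v : Module.End K V, u ^ N = 1 ∧ v * u = 1 ∧ ∀ x, φ x = u * x * v := by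
  rcases subsingleton_or_nontrivial V with hV | hV
  · exact ⟨1, 1, one_pow _, one_mul _, fun x => Subsingleton.elim _ _⟩
  have hbij : Function.Bijective φ := by
    have h : Function.Bijective ⇑(φ ^ N) := by rw [hφ]; exact Function.bijective_id
    obtain ⟨m, rfl⟩ := Nat.exists_eq_succ_of_ne_zero hN.ne'
    constructor
    · have h' := h.1
      rw [pow_succ] at h'
      exact Function.Injective.of_comp (f := ⇑(φ ^ m)) h'
    · have h' := h.2
      rw [pow_succ'] at h'
      exact Function.Surjective.of_comp (g := ⇑(φ ^ m)) h'
  obtain ⟨T, hT⟩ := (AlgEquiv.ofBijective φ hbij).eq_linearEquivConjAlgEquiv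
  have hTφ : ∀ x, φ x = T.toLinearMap * x * T.symm.toLinearMap := fun x =>
    congrArg (fun e : Module.End K V ≃ₐ[K] Module.End K V => e x) hT
  let t : Module.End K V := T.toLinearMap
  let t' : Module.End K V := T.symm.toLinearMap
  have ht : t' * t = 1 := by ext; simp [t, t']
  have hpow : ∀ m x, (φ ^ m) x * t ^ m = t ^ m * x := by
    intro m
    induction m with
    | zero => simp
    | succ m ih =>
      intro x
      rw [pow_succ', AlgHom.mul_apply, hTφ, pow_succ']
      change t * (φ ^ m) x * t' * (t * t ^ m) = _
      rw [mul_assoc, ← mul_assoc t', ht, one_mul, mul_assoc, ih, mul_assoc]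
  have hcomm : ∀ x, Commute (t ^ N) x := fun x => by
    have := hpow N x
    rw [hφ] at this
    exact this.symm
  obtain ⟨c, hc⟩ : ∃ c : K, t ^ N = c • 1 := by
    have : t ^ N ∈ Subalgebra.center K (Module.End K V) :=
      Subalgebra.mem_center_iff.mpr fun x => (hcomm x).symm
    rw [Algebra.IsCentral.center_eq_bot, Algebra.mem_bot] at this
    obtain ⟨c, hc⟩ := this
    exact ⟨c, by rw [← hc, Algebra.algebraMap_eq_smul_one]⟩
  obtain ⟨d, hd⟩ := IsAlgClosed.exists_pow_nat_eq c hN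
  have hd0 : d ≠ 0 := by
    rintro rfl
    rw [zero_pow hN.ne'] at hd
    have h1 : t' ^ N * t ^ N = 1 := by
      have : Commute t' t := by
        have h2 : t * t' = 1 := by ext; simp [t, t']
        exact ht.trans h2.symm
      rw [← this.mul_pow, ht, one_pow]
    rw [hc, ← hd, zero_smul, mul_zero] at h1
    exact zero_ne_one h1
  refine ⟨d⁻¹ • t, d • t', ?_, ?_, fun x => ?_⟩
  · rw [smul_pow, hc, ← hd, smul_smul, inv_pow, inv_mul_cancel₀ (pow_ne_zero _ hd0), one_smul]
  · rw [smul_mul_smul_comm, ht, mul_inv_cancel₀ hd0, one_smul]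
  · rw [hTφ, smul_mul_assoc, smul_mul_smul_comm, inv_mul_cancel₀ hd0, one_smul]

variable [CharZero K] [IsAlgClosed K]

lemma exists_trace_eq_mul (σ : algebraicClosure ℚ K →ₐ[ℚ] ℂ) {N : ℕ} (hN : 0 < N)
    (φ : Module.End K V →ₐ[K] Module.End K V) (hφ : φ ^ N = 1) :
    ∃ x y : K, (x, y) ∈ conjPairs σ ∧
      LinearMap.trace K (Module.End K V) φ.toLinearMap = x * y ∧
      ∀ h, ∃ c, LinearMap.trace K (Module.End K V) (LinearMap.mulLeft K h ∘ₗ φ.toLinearMap) =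
        c * y := by
  obtain ⟨u, v, hu, hvu, huv⟩ := exists_conj_pow_eq_one hN φ hφ
  refine ⟨_, _, trace_mem_conjPairs σ hN hu hvu, ?_, fun h => ⟨LinearMap.trace K V (h * u), ?_⟩⟩
  · rw [← trace_mulLeft_comp_mulRight]
    congr 1
    exact LinearMap.ext fun x => by simp [huv, mul_assoc]
  · rw [← trace_mulLeft_comp_mulRight]
    congr 1
    exact LinearMap.ext fun x => by simp [huv, mul_assoc]

end Automorphism

section Pi
variable {K : Type*} [Field K] {ι : Type*} [DecidableEq ι]

lemma trace_pi_eq_sum [Fintype ι] {W : ι → Type*} [∀ i, AddCommGroup (W i)] [∀ i, Module K (W i)]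
    [∀ i, FiniteDimensional K (W i)] (F : Module.End K (Π i, W i)) :
    LinearMap.trace K _ F =
      ∑ i, LinearMap.trace K _ (LinearMap.proj i ∘ₗ F ∘ₗ LinearMap.single K W i) := by
  have h : F = ∑ i, F ∘ₗ LinearMap.single K W i ∘ₗ LinearMap.proj i := by
    refine LinearMap.ext fun x => ?_
    conv_lhs => rw [← Finset.univ_sum_single x]
    simp
  conv_lhs => rw [h]
  rw [map_sum]
  refine Finset.sum_congr rfl fun i _ => ?_
  rw [← LinearMap.comp_assoc, LinearMap.trace_comp_comm']

variable {V : ι → Type*} [∀ i, AddCommGroup (V i)] [∀ i, Module K (V i)]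
  [∀ i, FiniteDimensional K (V i)] [CharZero K] [IsAlgClosed K]

lemma exists_trace_block_eq_mul (σ : algebraicClosure ℚ K →ₐ[ℚ] ℂ) {N : ℕ} (hN : 0 < N)
    (τ : (Π i, Module.End K (V i)) →ₐ[K] (Π i, Module.End K (V i))) (hτ : τ ^ N = 1) (i : ι) :
    ∃ x y : K, (x, y) ∈ conjPairs σ ∧
      LinearMap.trace K (Module.End K (V i)) (LinearMap.proj i ∘ₗ τ.toLinearMap ∘ₗ
        LinearMap.single K (fun i => Module.End K (V i)) i) = x * y ∧
      ∀ h, ∃ c, LinearMap.trace K (Module.End K (V i)) (LinearMap.mulLeft K h ∘ₗ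
        (LinearMap.proj i ∘ₗ τ.toLinearMap ∘ₗ
          LinearMap.single K (fun i => Module.End K (V i)) i)) = c * y := by
  set B : ι → Type _ := fun i => Module.End K (V i)
  have hbij : Function.Surjective τ := by
    obtain ⟨m, rfl⟩ := Nat.exists_eq_succ_of_ne_zero hN.ne'
    intro x
    refine ⟨(τ ^ m) x, ?_⟩
    rw [← AlgHom.mul_apply, ← pow_succ', hτ]
    rfl
  have hmul : ∀ y : Π i, B i, y * Pi.single i 1 = Pi.single i (y i) := by
    intro y
    ext1 j
    by_cases h : j = i
    · subst h; simp
    · simp [h]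
  have hmul' : ∀ y : Π i, B i, Pi.single i 1 * y = Pi.single i (y i) := by
    intro y
    ext1 j
    by_cases h : j = i
    · subst h; simp
    · simp [h]
  have hz : ∀ y : Π i, B i, τ y i * τ (Pi.single i 1) i = τ (Pi.single i (y i)) i := by
    intro y
    rw [← Pi.mul_apply, ← map_mul, hmul]
  have hz' : ∀ y : Π i, B i, τ (Pi.single i 1) i * τ y i = τ (Pi.single i (y i)) i := by
    intro y
    rw [← Pi.mul_apply, ← map_mul, hmul']
  obtain ⟨c, hc⟩ : ∃ c : K, τ (Pi.single i 1) i = c • (1 : B i) := by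
    have : τ (Pi.single i 1) i ∈ Subalgebra.center K (B i) := by
      refine Subalgebra.mem_center_iff.mpr fun b => ?_
      obtain ⟨y, hy⟩ := hbij (Pi.single i b)
      have hb : b = τ y i := by rw [hy, Pi.single_eq_same]
      rw [hb, hz, hz']
    rw [Algebra.IsCentral.center_eq_bot, Algebra.mem_bot] at this
    obtain ⟨c, hc⟩ := this
    exact ⟨c, by rw [← hc, Algebra.algebraMap_eq_smul_one]⟩
  have hcase : τ (Pi.single i 1) i = 0 ∨ τ (Pi.single i 1) i = 1 := by
    have h := hz (Pi.single i 1)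
    rw [Pi.single_eq_same, hc, smul_mul_smul_comm, mul_one] at h
    rw [hc]
    by_cases h0 : c = 0
    · simp [h0]
    · right
      have := congrArg (fun b : B i => c⁻¹ • b) h
      simpa [smul_smul, h0] using this
  rcases hcase with h | h
  · have h0 : (LinearMap.proj i ∘ₗ τ.toLinearMap ∘ₗ LinearMap.single K B i) = 0 := by
      refine LinearMap.ext fun b => ?_
      have := hz (Pi.single i b)
      rw [h, mul_zero, Pi.single_eq_same] at this
      exact this.symm
    refine ⟨0, 0, zero_mem _, ?_, fun _ => ⟨0, ?_⟩⟩
    · rw [h0]; simp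
    · rw [h0]; simp
  · let φ : B i →ₐ[K] B i := AlgHom.ofLinearMap
      (LinearMap.proj i ∘ₗ τ.toLinearMap ∘ₗ LinearMap.single K B i) h (fun a b => by
        change τ (Pi.single i (a * b)) i = τ (Pi.single i a) i * τ (Pi.single i b) i
        rw [← Pi.mul_apply, ← map_mul, ← Pi.single_mul])
    have hφ : ∀ y, φ (y i) = τ y i := fun y => by
      have := hz y
      rw [h, mul_one] at this
      exact this.symm
    have hφm : ∀ m y, (φ ^ m) (y i) = (τ ^ m) y i := by
      intro m
      induction m with
      | zero => intro y; rfl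
      | succ m ih => intro y; rw [pow_succ', pow_succ', AlgHom.mul_apply, AlgHom.mul_apply, ih, hφ]
    refine exists_trace_eq_mul σ hN φ (AlgHom.ext fun b => ?_)
    have := hφm N (Pi.single i b)
    rw [hτ] at this
    simpa using this

lemma trace_mulLeft_comp_eq_zero_of_pi [Fintype ι] {N : ℕ} (hN : 0 < N)
    (τ : (Π i, Module.End K (V i)) →ₐ[K] (Π i, Module.End K (V i))) (hτ : τ ^ N = 1)
    (h0 : LinearMap.trace K _ τ.toLinearMap = 0) (h : Π i, Module.End K (V i)) :
    LinearMap.trace K _ (LinearMap.mulLeft K h ∘ₗ τ.toLinearMap) = 0 := by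
  have : Algebra.IsAlgebraic ℚ (algebraicClosure ℚ K) := algebraicClosure.isAlgebraic ℚ K
  let σ : algebraicClosure ℚ K →ₐ[ℚ] ℂ := IsAlgClosed.lift
  choose x y hxy htr hL using exists_trace_block_eq_mul σ hN τ hτ
  rw [trace_pi_eq_sum] at h0
  simp only [htr] at h0
  have hy := eq_zero_of_sum_mul_eq_zero Finset.univ (fun i _ => hxy i) h0
  rw [trace_pi_eq_sum]
  refine Finset.sum_eq_zero fun i _ => ?_
  obtain ⟨c, hc⟩ := hL i (h i)
  rw [hy i (Finset.mem_univ i), mul_zero] at hc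
  exact hc

end Pi

section Semisimple
variable {K A : Type*} [Field K] [CharZero K] [IsAlgClosed K] [Ring A] [Algebra K A]
  [FiniteDimensional K A] [IsSemisimpleRing A]

/-- If an automorphism of finite order of a semisimple algebra has trace zero, then so do all its
composites with left multiplications. -/
theorem trace_mulLeft_comp_eq_zero {N : ℕ} (hN : 0 < N) (τ : A →ₐ[K] A) (hτ : τ ^ N = 1)
    (h0 : LinearMap.trace K A τ.toLinearMap = 0) (h : A) :
    LinearMap.trace K A (LinearMap.mulLeft K h ∘ₗ τ.toLinearMap) = 0 := by
  obtain ⟨n, d, _, ⟨e₀⟩⟩ := IsSemisimpleRing.exists_algEquiv_pi_matrix_of_isAlgClosed K A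
  let e : A ≃ₐ[K] Π i, Module.End K (Fin (d i) → K) :=
    e₀.trans (AlgEquiv.piCongrRight fun i => Matrix.toLinAlgEquiv')
  let τ' := e.toAlgHom.comp (τ.comp e.symm.toAlgHom)
  have hpow : ∀ m x, (τ' ^ m) (e x) = e ((τ ^ m) x) := by
    intro m
    induction m with
    | zero => intro x; rfl
    | succ m ih =>
      intro x
      rw [pow_succ', pow_succ', AlgHom.mul_apply, ih]
      simp [τ']
  have hτ' : τ' ^ N = 1 := by
    refine AlgHom.ext fun y => ?_
    obtain ⟨x, rfl⟩ := e.surjective y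
    rw [hpow, hτ]
    rfl
  rw [← trace_eq_of_intertwining e.toLinearEquiv τ.toLinearMap τ'.toLinearMap
    fun x => by simp [τ']] at h0
  rw [← trace_eq_of_intertwining e.toLinearEquiv (LinearMap.mulLeft K h ∘ₗ τ.toLinearMap)
    (LinearMap.mulLeft K (e h) ∘ₗ τ'.toLinearMap) fun x => by simp [τ']]
  exact trace_mulLeft_comp_eq_zero_of_pi hN τ' hτ' h0 (e h)

end Semisimple

section TraceNeZero
variable {k H : Type*} [Field k] [Ring H] [HopfAlgebra k H]

local notation "𝑺" => HopfAlgebra.antipode k (A := H)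

lemma isSemisimpleRing_tensorProduct (K : Type*) [Field K] [Algebra k K] {Λ : H}
    (hl : IsLeftIntegral k Λ) (h1 : counit (R := k) Λ = 1) : IsSemisimpleRing (K ⊗[k] H) := by
  have hΛ : IsLeftIntegral K ((1 : K) ⊗ₜ[k] Λ) := by
    intro x
    induction x with
    | zero => simp
    | tmul a h =>
      rw [Algebra.TensorProduct.tmul_mul_tmul, mul_one, hl, TensorProduct.counit_tmul]
      simp [smul_tmul']
    | add x y hx hy => rw [add_mul, hx, hy, map_add, add_smul]
  exact hΛ.isSemisimpleRing (by simp [h1])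

lemma trace_antipode_sq_ne_zero [CharZero k] [FiniteDimensional k H] {Λ : H}
    (hr : IsRightIntegral k Λ) (hl : IsLeftIntegral k Λ)
    (h1 : counit (R := k) Λ = 1) : LinearMap.trace k H (𝑺 ∘ₗ 𝑺) ≠ 0 := by
  intro h0
  let K := AlgebraicClosure k
  have : CharZero K := charZero_of_injective_algebraMap (algebraMap k K).injective
  have := isSemisimpleRing_tensorProduct K hl h1
  let τ : K ⊗[k] H →ₐ[K] K ⊗[k] H := Algebra.TensorProduct.map (AlgHom.id K K) (antipodeSq k H)
  obtain ⟨N, hN, hpow⟩ := exists_antipodeSq_pow_eq_one hr hl h1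
  have hτ : τ ^ N = 1 := by
    have h : ∀ m (a : K) (x : H), (τ ^ m) (a ⊗ₜ x) = a ⊗ₜ ((antipodeSq k H) ^ m) x := by
      intro m
      induction m with
      | zero => intro a x; rfl
      | succ m ih =>
        intro a x
        rw [pow_succ', pow_succ', AlgHom.mul_apply, AlgHom.mul_apply, ih]
        rfl
    refine AlgHom.ext fun t => ?_
    induction t with
    | zero => simp
    | tmul a x => rw [h, hpow]; rfl
    | add x y hx hy => rw [map_add, map_add, hx, hy]
  have e₁ : τ.toLinearMap = (antipodeSq k H).toLinearMap.baseChange K := by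
    ext x; simp [τ]
  have e₂ : LinearMap.mulLeft K ((1 : K) ⊗ₜ[k] Λ) ∘ₗ τ.toLinearMap =
      (LinearMap.mulLeft k Λ ∘ₗ (antipodeSq k H).toLinearMap).baseChange K := by
    ext x; simp [τ]
  have h := trace_mulLeft_comp_eq_zero hN τ hτ (by
    rw [e₁, LinearMap.trace_baseChange, toLinearMap_antipodeSq, h0, map_zero]) (1 ⊗ₜ[k] Λ)
  rw [e₂, LinearMap.trace_baseChange, ← traceForm_apply, hr.traceForm_eq, h1, map_one] at h
  exact one_ne_zero h

end TraceNeZero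

section Involution
variable {K V : Type*} [Field K] [AddCommGroup V] [Module K V]
  [FiniteDimensional K V]

lemma exists_nat_trace_eq_of_isIdempotentElem {f : Module.End K V} (hf : IsIdempotentElem f) :
    ∃ m : ℕ, LinearMap.trace K V f = m :=
  ⟨_, (LinearMap.IsIdempotentElem.isProj_range f hf).trace⟩

variable [CharZero K]

/-- An involution `T` whose trace is `dim V` times the trace of its composite with a commuting
idempotent is a scalar, as soon as its trace is nonzero. -/
lemma eq_one_or_eq_neg_one_of_trace {T E : Module.End K V} (hT : T * T = 1)
    (hE : IsIdempotentElem E) (hc : Commute T E) (h0 : LinearMap.trace K V T ≠ 0)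
    (h : (Module.finrank K V : K) * LinearMap.trace K V (E * T) = LinearMap.trace K V T) :
    T = 1 ∨ T = -1 := by
  let P : Module.End K V := (2⁻¹ : K) • (1 + T)
  let Q : Module.End K V := (2⁻¹ : K) • (1 - T)
  have h4 : (2⁻¹ * 2⁻¹ : K) * 2 = 2⁻¹ := by norm_num
  have hP : IsIdempotentElem P := by
    have : (1 + T) * (1 + T) = (2 : K) • (1 + T) := by
      rw [two_smul, mul_add, add_mul, add_mul, hT]; simp; abel
    change P * P = P
    rw [smul_mul_smul_comm, this, smul_smul, h4]
  have hQ : IsIdempotentElem Q := by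
    have : (1 - T) * (1 - T) = (2 : K) • (1 - T) := by
      rw [two_smul, mul_sub, sub_mul, sub_mul, hT]; simp; abel
    change Q * Q = Q
    rw [smul_mul_smul_comm, this, smul_smul, h4]
  have hPE : Commute P E := ((Commute.one_left E).add_left hc).smul_left _
  have hQE : Commute Q E := ((Commute.one_left E).sub_left hc).smul_left _
  have hPQ : P + Q = 1 := by
    rw [← smul_add, show (1 + T) + (1 - T) = (2 : K) • (1 : Module.End K V) by
      rw [two_smul]; abel, smul_smul]
    simp
  have hPT : P - Q = T := by
    rw [← smul_sub, show (1 + T) - (1 - T) = (2 : K) • T by rw [two_smul]; abel, smul_smul]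
    simp
  obtain ⟨p, hp⟩ := exists_nat_trace_eq_of_isIdempotentElem hP
  obtain ⟨q, hq⟩ := exists_nat_trace_eq_of_isIdempotentElem hQ
  obtain ⟨a, ha⟩ := exists_nat_trace_eq_of_isIdempotentElem (hE.mul_of_commute hPE.symm hP)
  obtain ⟨b, hb⟩ := exists_nat_trace_eq_of_isIdempotentElem (hE.mul_of_commute hQE.symm hQ)
  have e₁ : (p : K) + q = Module.finrank K V := by
    rw [← hp, ← hq, ← map_add, hPQ, LinearMap.trace_one]
  have e₂ : LinearMap.trace K V T = p - q := by rw [← hp, ← hq, ← map_sub, hPT]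
  have e₃ : LinearMap.trace K V (E * T) = a - b := by
    rw [← ha, ← hb, ← map_sub, ← mul_sub, hPT]
  rw [e₃, ← e₁, e₂] at h
  rw [e₂] at h0
  have h' : ((p : ℤ) + q) * (a - b) = p - q := by exact_mod_cast h
  have h0' : (p : ℤ) - q ≠ 0 := by exact_mod_cast h0
  have hab : (a : ℤ) - b ≠ 0 := fun h => h0' (by rw [← h', h, mul_zero])
  have : p = 0 ∨ q = 0 := by
    by_contra! hpq
    have hp1 : 0 < p := Nat.pos_of_ne_zero hpq.1
    have hq1 : 0 < q := Nat.pos_of_ne_zero hpq.2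
    rcases lt_or_gt_of_ne hab with h1 | h1 <;> nlinarith
  rcases this with h | h
  · right
    have : P = 0 := by
      rw [← LinearMap.IsIdempotentElem.trace_eq_zero_iff hP, hp, h, Nat.cast_zero]
    rw [this, zero_add] at hPQ
    rw [← hPT, this, hPQ, zero_sub]
  · left
    have : Q = 0 := by
      rw [← LinearMap.IsIdempotentElem.trace_eq_zero_iff hQ, hq, h, Nat.cast_zero]
    rw [this, add_zero] at hPQ
    rw [← hPT, this, hPQ, sub_zero]

end Involution

section RegularCharacter
variable {k H : Type*} [Field k] [Ring H] [HopfAlgebra k H]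

local notation "𝑺" => HopfAlgebra.antipode k (A := H)
local notation "Δ" => comul (R := k) (A := H)

variable (k H) in
/-- The character of the right regular representation. -/
def rightRegularCharacter : HopfDual k H :=
  HopfDual.toDual.symm (LinearMap.trace k H ∘ₗ (LinearMap.mul k H).flip)

lemma rightRegularCharacter_apply (a : H) :
    HopfDual.toDual (rightRegularCharacter k H) a =
      LinearMap.trace k H (LinearMap.mulRight k a) := rfl

variable (k H) in
/-- The Galois map `a ⊗ b ↦ (a ⊗ 1) Δ(b)`. -/
def galoisMap : H ⊗[k] H →ₗ[k] H ⊗[k] H :=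
  TensorProduct.lift ((LinearMap.mul k (H ⊗[k] H)).compl₁₂
    (Algebra.TensorProduct.includeLeft (R := k) (S := k) (A := H) (B := H)).toLinearMap Δ)

lemma galoisMap_tmul (a b : H) : galoisMap k H (a ⊗ₜ b) = (a ⊗ₜ 1) * Δ b := rfl

variable [FiniteDimensional k H]

lemma toDual_leftHit (q : HopfDual k H) (x y : H) :
    HopfDual.toDual (leftHit (k := k)
      ((LinearMap.applyₗ x) ∘ₗ (HopfDual.toDual (k := k) (H := H)).toLinearMap) q) y =
      HopfDual.toDual q (x * y) := by
  rw [← HopfDual.apply_evalLeft_comul]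
  rfl

variable (k H) in
/-- The trace form of the dual is represented by a left integral. -/
lemma exists_isLeftIntegral_traceForm_hopfDual :
    ∃ F : H, IsLeftIntegral k F ∧
      (∀ q : HopfDual k H, traceForm k (HopfDual k H) q = HopfDual.toDual q F) ∧
      counit (R := k) F = LinearMap.trace k H (𝑺 ∘ₗ 𝑺) := by
  let F : H := (Module.evalEquiv k H).symm
    (traceForm k (HopfDual k H) ∘ₗ HopfDual.toDual.symm.toLinearMap)
  have hF : ∀ q : HopfDual k H, traceForm k (HopfDual k H) q = HopfDual.toDual q F := by
    intro q
    have := Module.apply_evalEquiv_symm_apply k H (HopfDual.toDual q)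
      (traceForm k (HopfDual k H) ∘ₗ HopfDual.toDual.symm.toLinearMap)
    rw [this]
    simp
  refine ⟨F, fun h => ?_, hF, ?_⟩
  · rw [← sub_eq_zero, ← Module.forall_dual_apply_eq_zero_iff k]
    intro p
    obtain ⟨q, rfl⟩ := HopfDual.toDual.surjective p
    rw [map_sub, map_smul, ← toDual_leftHit, ← hF, traceForm_leftHit, hF, sub_eq_zero]
    exact congrArg (· * _) (HopfDual.one_apply h)
  · rw [← HopfDual.trace_antipode_sq, ← traceForm_one, hF, HopfDual.one_apply]

lemma IsLeftIntegral.rightRegularCharacter_apply {F : H} (hF : IsLeftIntegral k F) :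
    HopfDual.toDual (rightRegularCharacter k H) F = counit (R := k) F := by
  have : LinearMap.mulRight k F = (counit (R := k) (A := H)).smulRight F :=
    LinearMap.ext fun h => hF h
  rw [_root_.rightRegularCharacter_apply, this, LinearMap.trace_smulRight]

variable (k H) in
lemma galoisMap_bijective : Function.Bijective (galoisMap k H) := by
  have hs : Function.Surjective (galoisMap k H) := by
    rw [← LinearMap.range_eq_top, eq_top_iff, ← TensorProduct.span_tmul_eq_top,
      Submodule.span_le]
    rintro _ ⟨a, h, rfl⟩
    refine ⟨∑ i ∈ (ℛ k h).index, (a * 𝑺 ((ℛ k h).left i)) ⊗ₜ (ℛ k h).right i, ?_⟩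
    have := congrArg (fun t => (a ⊗ₜ[k] (1 : H)) * t) (sum_antipode_tmul_mul_comul (k := k) h)
    simp only [Finset.mul_sum, ← mul_assoc, Algebra.TensorProduct.tmul_mul_tmul, one_mul,
      mul_one] at this
    simpa only [map_sum, galoisMap_tmul] using this
  exact ⟨(LinearMap.injective_iff_surjective).mpr hs, hs⟩

lemma rightRegularCharacter_mul_self :
    rightRegularCharacter k H * rightRegularCharacter k H =
      (Module.finrank k H : k) • rightRegularCharacter k H := by
  apply HopfDual.toDual.injective
  ext a
  have h₁ := trace_eq_of_intertwining (LinearEquiv.ofBijective _ (galoisMap_bijective k H))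
    (TensorProduct.map LinearMap.id (LinearMap.mulRight k a)) (LinearMap.mulRight k (Δ a))
    (fun t => by
      induction t with
      | zero => simp
      | tmul x y => simp [galoisMap_tmul, mul_assoc]
      | add x y hx hy => rw [map_add, map_add, map_add, map_add, hx, hy])
  have h₂ : LinearMap.mulRight k (Δ a) = ∑ i ∈ (ℛ k a).index, TensorProduct.map
      (LinearMap.mulRight k ((ℛ k a).left i)) (LinearMap.mulRight k ((ℛ k a).right i)) := by
    ext x y
    conv_lhs => rw [← (ℛ k a).eq]
    simp [Finset.mul_sum]
  rw [h₂, map_sum] at h₁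
  simp only [LinearMap.trace_tensorProduct', LinearMap.trace_id] at h₁
  rw [HopfDual.mul_eval (ℛ k a)]
  simpa [rightRegularCharacter_apply] using h₁

lemma toDual_antipodeSq (q : HopfDual k H) (x : H) :
    HopfDual.toDual (antipodeSq k (HopfDual k H) q) x = HopfDual.toDual q (antipodeSq k H x) := by
  rw [antipodeSq_apply, HopfDual.antipode_apply, HopfDual.antipode_apply, antipodeSq_apply]

lemma antipodeSq_rightRegularCharacter
    (hS : ∀ h, antipodeSq k H (antipodeSq k H h) = h) :
    antipodeSq k (HopfDual k H) (rightRegularCharacter k H) = rightRegularCharacter k H := by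
  apply HopfDual.toDual.injective
  ext x
  rw [toDual_antipodeSq, rightRegularCharacter_apply, rightRegularCharacter_apply]
  exact trace_eq_of_intertwining
    (LinearEquiv.ofInvolutive (antipodeSq k H).toLinearMap hS) _ _ fun y =>
      (map_mul (antipodeSq k H) y x).symm

variable (k H) in
lemma isSemisimpleRing_of_trace_antipode_sq_ne_zero (h0 : LinearMap.trace k H (𝑺 ∘ₗ 𝑺) ≠ 0) :
    IsSemisimpleRing H := by
  obtain ⟨F, hF, -, h⟩ := exists_isLeftIntegral_traceForm_hopfDual k H
  exact hF.isSemisimpleRing (h ▸ h0)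

variable (k H) in
lemma antipode_comp_antipode_of_trace_ne_zero [CharZero k]
    (h0 : LinearMap.trace k H (𝑺 ∘ₗ 𝑺) ≠ 0) : 𝑺 ∘ₗ 𝑺 = LinearMap.id := by
  obtain ⟨F, hF, hFt, hFc⟩ := exists_isLeftIntegral_traceForm_hopfDual k H
  have := isSemisimpleRing_of_trace_antipode_sq_ne_zero k H h0
  obtain ⟨Λ, hl, hr, h1⟩ := exists_isLeftIntegral_isRightIntegral (k := k) (H := H)
  have hS := antipodeSq_antipodeSq hr hl h1 h0
  let T : Module.End k (HopfDual k H) := (antipodeSq k (HopfDual k H)).toLinearMap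
  let χ := rightRegularCharacter k H
  have hχ : antipodeSq k (HopfDual k H) χ = χ := antipodeSq_rightRegularCharacter hS
  let n : k := Module.finrank k H
  have hn : n ≠ 0 := by
    have : Nontrivial H := by
      refine nontrivial_of_ne Λ 0 ?_
      rintro rfl
      simp at h1
    exact Nat.cast_ne_zero.mpr Module.finrank_pos.ne'
  let E : Module.End k (HopfDual k H) := n⁻¹ • LinearMap.mulLeft k χ
  have htr : LinearMap.trace k (HopfDual k H) T = LinearMap.trace k H (𝑺 ∘ₗ 𝑺) :=
    HopfDual.trace_antipode_sq
  have hT : T * T = 1 := by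
    ext q : 1
    apply HopfDual.toDual.injective
    ext x
    change HopfDual.toDual (antipodeSq k (HopfDual k H) (antipodeSq k (HopfDual k H) q)) x = _
    rw [toDual_antipodeSq, toDual_antipodeSq, hS]
    rfl
  have hE : IsIdempotentElem E := by
    change E * E = E
    have : LinearMap.mulLeft k χ * LinearMap.mulLeft k χ = n • LinearMap.mulLeft k χ := by
      ext q : 1
      simp only [Module.End.mul_apply, LinearMap.mulLeft_apply, LinearMap.smul_apply,
        ← mul_assoc]
      rw [rightRegularCharacter_mul_self, smul_mul_assoc]
    rw [smul_mul_smul_comm, this, smul_smul, mul_assoc, inv_mul_cancel₀ hn, mul_one]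
  have hc : Commute T E := by
    refine Commute.smul_right ?_ _
    ext q : 1
    change antipodeSq k (HopfDual k H) (χ * q) = χ * antipodeSq k (HopfDual k H) q
    rw [map_mul, hχ]
  have hET : n * LinearMap.trace k _ (E * T) = LinearMap.trace k _ T := by
    have h := hF.rightRegularCharacter_apply
    rw [← hFt, traceForm_apply, hFc, ← htr] at h
    rw [smul_mul_assoc, map_smul, smul_eq_mul, ← mul_assoc, mul_inv_cancel₀ hn, one_mul]
    exact h
  have hfin : (Module.finrank k (HopfDual k H)) = Module.finrank k H := by
    rw [LinearEquiv.finrank_eq (HopfDual.toDual (k := k) (H := H)), Subspace.dual_finrank_eq]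
  rcases eq_one_or_eq_neg_one_of_trace hT hE hc (by rw [htr]; exact h0)
    (by rw [hfin]; exact hET) with h | h
  · ext x
    rw [← sub_eq_zero, ← Module.forall_dual_apply_eq_zero_iff k]
    intro p
    obtain ⟨q, rfl⟩ := HopfDual.toDual.surjective p
    have h2 := LinearMap.congr_fun h q
    have h3 := toDual_antipodeSq q x
    rw [show antipodeSq k (HopfDual k H) q = q from h2] at h3
    rw [map_sub, sub_eq_zero]
    exact h3.symm
  · exfalso
    have h2 : T 1 = 1 := map_one (antipodeSq k (HopfDual k H))
    rw [h] at h2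
    have h3 := congrArg (fun q => HopfDual.toDual q (1 : H)) h2
    simp only [LinearMap.neg_apply, Module.End.one_apply, map_neg, HopfDual.one_apply,
      Bialgebra.counit_one] at h3
    norm_num [neg_eq_iff_add_eq_zero] at h3

end RegularCharacter

section Hits
variable {k H : Type*} [Field k] [Ring H] [HopfAlgebra k H]

local notation "𝑺" => HopfAlgebra.antipode k (A := H)
local notation "Δ" => comul (R := k) (A := H)

lemma leftHit_one (p : Module.Dual k H) : leftHit p (1 : H) = p 1 • 1 := by
  simp [leftHit, Algebra.TensorProduct.one_def]

lemma rightHit_one (p : Module.Dual k H) : rightHit p (1 : H) = p 1 • 1 := by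
  simp [rightHit, Algebra.TensorProduct.one_def]

lemma commute_leftHit_rightHit (p q : Module.Dual k H) : Commute (leftHit p) (rightHit q) := by
  have h : ∀ t : H ⊗[k] H, contractSnd q ((leftHit p).rTensor H t) =
      leftHit p (contractSnd q t) := by
    intro t
    induction t with
    | zero => simp
    | tmul x y => simp
    | add x y hx hy => simp only [map_add, hx, hy]
  refine LinearMap.ext fun a => ?_
  change leftHit p (contractSnd q (Δ a)) = contractSnd q (Δ (leftHit p a))
  rw [comul_leftHit, h]

lemma toDual_mul_eq_comp_leftHit (p q : HopfDual k H) :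
    HopfDual.toDual (p * q) = HopfDual.toDual q ∘ₗ leftHit (HopfDual.toDual p) := by
  ext a
  rw [HopfDual.mul_eval (ℛ k a), LinearMap.comp_apply, leftHit_apply _ (ℛ k a)]
  simp

lemma toDual_mul_eq_comp_rightHit (p q : HopfDual k H) :
    HopfDual.toDual (p * q) = HopfDual.toDual p ∘ₗ rightHit (HopfDual.toDual q) := by
  rw [toDual_mul_eq_comp_leftHit]
  exact LinearMap.ext fun a => (apply_rightHit _ _ a).symm

lemma toDual_one_eq_counit : HopfDual.toDual (1 : HopfDual k H) = counit :=
  LinearMap.ext HopfDual.one_apply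

lemma rightHit_counit : rightHit (counit : H →ₗ[k] k) = 1 :=
  LinearMap.ext fun a => by rw [rightHit_apply _ (ℛ k a), sum_counit_right_smul]; rfl

lemma leftHit_counit : leftHit (counit : H →ₗ[k] k) = 1 :=
  LinearMap.ext fun a => by rw [leftHit_apply _ (ℛ k a), sum_counit_smul]; rfl

variable (k H) in
/-- The dual acting by right hits. -/
def rightHitAlgHom : HopfDual k H →ₐ[k] Module.End k H :=
  AlgHom.ofLinearMap
    { toFun := fun p => rightHit (HopfDual.toDual p)
      map_add' := fun p q => LinearMap.ext fun a => by
        simp [rightHit_apply _ (ℛ k a), add_smul, Finset.sum_add_distrib]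
      map_smul' := fun c p => LinearMap.ext fun a => by
        simp [rightHit_apply _ (ℛ k a), mul_smul, Finset.smul_sum] }
    (by
      change rightHit (HopfDual.toDual (1 : HopfDual k H)) = 1
      rw [toDual_one_eq_counit, rightHit_counit])
    (fun p q => LinearMap.ext fun a => by
      change rightHit (HopfDual.toDual (p * q)) a = _
      rw [toDual_mul_eq_comp_leftHit, rightHit_comp_leftHit]
      rfl)

variable (k H) in
/-- The opposite of the dual acting by left hits. -/
def leftHitAlgHom : (HopfDual k H)ᵐᵒᵖ →ₐ[k] Module.End k H :=
  AlgHom.ofLinearMap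
    { toFun := fun p => leftHit (HopfDual.toDual p.unop)
      map_add' := fun p q => LinearMap.ext fun a => by
        simp [leftHit_apply _ (ℛ k a), add_smul, Finset.sum_add_distrib]
      map_smul' := fun c p => LinearMap.ext fun a => by
        simp [leftHit_apply _ (ℛ k a), mul_smul, Finset.smul_sum] }
    (by
      change leftHit (HopfDual.toDual (1 : HopfDual k H)) = 1
      rw [toDual_one_eq_counit, leftHit_counit])
    (fun p q => LinearMap.ext fun a => by
      change leftHit (HopfDual.toDual (q.unop * p.unop)) a =
        leftHit (HopfDual.toDual p.unop) (leftHit (HopfDual.toDual q.unop) a)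
      rw [← sub_eq_zero, ← Module.forall_dual_apply_eq_zero_iff k]
      intro r
      have h := LinearMap.congr_fun
        (commute_leftHit_rightHit (HopfDual.toDual q.unop) r).eq a
      rw [Module.End.mul_apply, Module.End.mul_apply] at h
      rw [map_sub, ← apply_rightHit, toDual_mul_eq_comp_leftHit, LinearMap.comp_apply, h,
        apply_rightHit, sub_self])

lemma IsSubcoalgebra.leftHit_mem {V : Submodule k H} (hV : IsSubcoalgebra k V)
    (p : Module.Dual k H) {x : H} (hx : x ∈ V) : leftHit p x ∈ V := by
  obtain ⟨t, ht⟩ := hV x hx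
  rw [leftHit, LinearMap.comp_apply, ← ht]
  clear ht
  induction t with
  | zero => simp
  | tmul x y => simpa using V.smul_mem _ y.2
  | add x y hx hy => simpa only [map_add] using V.add_mem hx hy

lemma IsSubcoalgebra.rightHit_mem {V : Submodule k H} (hV : IsSubcoalgebra k V)
    (p : Module.Dual k H) {x : H} (hx : x ∈ V) : rightHit p x ∈ V := by
  obtain ⟨t, ht⟩ := hV x hx
  rw [rightHit, LinearMap.comp_apply, ← ht]
  clear ht
  induction t with
  | zero => simp
  | tmul x y => simpa using V.smul_mem _ x.2
  | add x y hx hy => simpa only [map_add] using V.add_mem hx hy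

variable (k H) in
/-- The algebra of operators generated by the left and right hits. -/
def hitAlgebra : Subalgebra k (Module.End k H) :=
  Algebra.adjoin k (Set.range leftHit ∪ Set.range rightHit)

lemma leftHit_mem_hitAlgebra (p : Module.Dual k H) : leftHit p ∈ hitAlgebra k H :=
  Algebra.subset_adjoin (.inl ⟨p, rfl⟩)

lemma rightHit_mem_hitAlgebra (p : Module.Dual k H) : rightHit p ∈ hitAlgebra k H :=
  Algebra.subset_adjoin (.inr ⟨p, rfl⟩)

lemma commute_of_mem_hitAlgebra {P : Module.End k H} (hl : ∀ p, Commute (leftHit p) P)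
    (hr : ∀ p, Commute (rightHit p) P) {f : Module.End k H} (hf : f ∈ hitAlgebra k H) :
    Commute f P := by
  induction hf using Algebra.adjoin_induction with
  | mem f hf =>
    rcases hf with ⟨p, rfl⟩ | ⟨p, rfl⟩
    exacts [hl p, hr p]
  | algebraMap c => exact Algebra.commute_algebraMap_left c P
  | add f g _ _ hf hg => exact hf.add_left hg
  | mul f g _ _ hf hg => exact hf.mul_left hg

/-- A subcoalgebra as a submodule over `hitAlgebra`. -/
def IsSubcoalgebra.toSubmodule {V : Submodule k H} (hV : IsSubcoalgebra k V) :
    Submodule (hitAlgebra k H) H :=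
  { V with
    smul_mem' := by
      rintro ⟨f, hf⟩ x hx
      change f x ∈ V
      replace hx : x ∈ V := hx
      induction hf using Algebra.adjoin_induction generalizing x with
      | mem f hf =>
        rcases hf with ⟨p, rfl⟩ | ⟨p, rfl⟩
        exacts [hV.leftHit_mem p hx, hV.rightHit_mem p hx]
      | algebraMap c => exact V.smul_mem c hx
      | add f g _ _ hf hg => exact V.add_mem (hf hx) (hg hx)
      | mul f g _ _ hf hg => exact hf (hg hx) }

variable [FiniteDimensional k H]

lemma isSubcoalgebra_of_hit_mem {V : Submodule k H}
    (hl : ∀ p : Module.Dual k H, ∀ x ∈ V, leftHit p x ∈ V)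
    (hr : ∀ p : Module.Dual k H, ∀ x ∈ V, rightHit p x ∈ V) : IsSubcoalgebra k V := by
  intro x hx
  obtain ⟨P, hP₁, hP₂⟩ := exists_projection V
  have h₁ : P.lTensor H (Δ x) = Δ x := by
    refine evalLeft_ext (Module.evalEquiv k H) fun p => ?_
    rw [evalLeft_lTensor]
    exact hP₂ _ (hl p x hx)
  have h₂ : P.rTensor H (Δ x) = Δ x := by
    apply (TensorProduct.comm k H H).injective
    refine evalLeft_ext (Module.evalEquiv k H) fun p => ?_
    rw [← LinearMap.lTensor_comm, evalLeft_lTensor]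
    exact hP₂ _ (hr p x hx)
  let P' : H →ₗ[k] V := P.codRestrict V hP₁
  refine ⟨TensorProduct.map P' P' (Δ x), ?_⟩
  rw [← LinearMap.comp_apply, ← TensorProduct.map_comp]
  change TensorProduct.map P P (Δ x) = _
  rw [← LinearMap.rTensor_comp_lTensor, LinearMap.comp_apply, h₁, h₂]

lemma isSubcoalgebra_restrictScalars (N : Submodule (hitAlgebra k H) H) :
    IsSubcoalgebra k (N.restrictScalars k) :=
  isSubcoalgebra_of_hit_mem
    (fun p _ hx => N.smul_mem ⟨leftHit p, leftHit_mem_hitAlgebra p⟩ hx)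
    (fun p _ hx => N.smul_mem ⟨rightHit p, rightHit_mem_hitAlgebra p⟩ hx)

lemma isSubcoalgebra_sSup {S : Set (Submodule k H)} (hS : ∀ V ∈ S, IsSubcoalgebra k V) :
    IsSubcoalgebra k (sSup S) := by
  have key : ∀ f : Module.End k H, (∀ V ∈ S, ∀ x ∈ V, f x ∈ V) → sSup S ≤ (sSup S).comap f :=
    fun f hf => sSup_le fun V hV x hx => (le_sSup hV : V ≤ sSup S) (hf V hV x hx)
  exact isSubcoalgebra_of_hit_mem
    (fun p => key _ fun V hV x hx => (hS V hV).leftHit_mem p hx)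
    (fun p => key _ fun V hV x hx => (hS V hV).rightHit_mem p hx)

lemma isAtom_iff_simple_subcoalgebra (N : Submodule (hitAlgebra k H) H) :
    IsAtom N ↔ N.restrictScalars k ≠ ⊥ ∧
      ∀ W ≤ N.restrictScalars k, IsSubcoalgebra k W → W = ⊥ ∨ W = N.restrictScalars k := by
  have hbot : ∀ W : Submodule (hitAlgebra k H) H, W.restrictScalars k = ⊥ ↔ W = ⊥ := fun W =>
    Submodule.restrictScalars_eq_bot_iff k _ _
  rw [IsAtom, Ne, Ne, hbot]
  refine and_congr_right fun _ => ⟨fun h W hW hWc => ?_, fun h W hW => ?_⟩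
  · rcases eq_or_lt_of_le (show hWc.toSubmodule ≤ N from hW) with h' | h'
    · right
      rw [← h']
      rfl
    · left
      exact (hbot _).mpr (h _ h')
  · rcases h (W.restrictScalars k) hW.le (isSubcoalgebra_restrictScalars W) with h' | h'
    · exact (hbot W).mp h'
    · exact absurd (Submodule.restrictScalars_injective k _ _ h') hW.ne

variable (k H) in
lemma isCosemisimple_iff_isSemisimpleModule :
    IsCosemisimple k H ↔ IsSemisimpleModule (hitAlgebra k H) H := by
  rw [← sSup_simples_eq_top_iff_isSemisimpleModule]
  simp only [isSimpleModule_iff_isAtom, isAtom_iff_simple_subcoalgebra, IsCosemisimple]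
  constructor
  · intro h
    rw [eq_top_iff, ← Submodule.restrictScalars_le (S := k), Submodule.restrictScalars_top, ← h]
    refine sSup_le fun V hV => ?_
    have hle : hV.1.toSubmodule ≤ sSup {N : Submodule (hitAlgebra k H) H |
        N.restrictScalars k ≠ ⊥ ∧ ∀ W ≤ N.restrictScalars k, IsSubcoalgebra k W →
          W = ⊥ ∨ W = N.restrictScalars k} := le_sSup hV.2
    exact hle
  · intro h
    have hS := isSubcoalgebra_sSup (k := k) (S := {V : Submodule k H | IsSubcoalgebra k V ∧ V ≠ ⊥ ∧
      ∀ W ≤ V, IsSubcoalgebra k W → W = ⊥ ∨ W = V}) fun V hV => hV.1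
    have h' : ⊤ ≤ hS.toSubmodule := by
      rw [← h]
      refine sSup_le fun N hN => ?_
      have hle : N.restrictScalars k ≤ sSup {V : Submodule k H | IsSubcoalgebra k V ∧ V ≠ ⊥ ∧
          ∀ W ≤ V, IsSubcoalgebra k W → W = ⊥ ∨ W = V} :=
        le_sSup ⟨isSubcoalgebra_restrictScalars N, hN⟩
      exact hle
    exact eq_top_iff.mpr h'

variable (k H) in
lemma isCosemisimple_of_trace_antipode_sq_ne_zero
    (h0 : LinearMap.trace k H (𝑺 ∘ₗ 𝑺) ≠ 0) : IsCosemisimple k H := by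
  let c := LinearMap.trace k H (𝑺 ∘ₗ 𝑺)
  let Λ : HopfDual k H := c⁻¹ • HopfDual.toDual.symm (traceForm k H)
  have hΛ : IsLeftIntegral k Λ := by
    intro p
    rw [mul_smul_comm, smul_comm]
    congr 1
    apply HopfDual.toDual.injective
    ext a
    rw [toDual_mul_eq_comp_leftHit]
    simp [traceForm_leftHit, HopfDual.counit_apply]
  have h1 : counit (R := k) Λ = 1 := by
    rw [HopfDual.counit_apply]
    simp [Λ, traceForm_one, c, h0]
  obtain ⟨e, he⟩ : ∃ e : HopfDual k H ⊗[k] HopfDual k H, IsSeparabilityTensor e :=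
    ⟨_, hΛ.isSeparabilityTensor h1⟩
  rw [isCosemisimple_iff_isSemisimpleModule]
  refine (isSemisimpleModule_iff ..).2 ⟨fun N => ?_⟩
  obtain ⟨P, hP₁, hP₂⟩ := exists_projection (N.restrictScalars k)
  have hN := isSubcoalgebra_restrictScalars N
  have hr : ∀ p, ∀ x ∈ N.restrictScalars k, rightHitAlgHom k H p x ∈ N.restrictScalars k :=
    fun p x hx => hN.rightHit_mem _ hx
  have hl : ∀ p, ∀ x ∈ N.restrictScalars k, leftHitAlgHom k H p x ∈ N.restrictScalars k :=
    fun p x hx => hN.leftHit_mem _ hx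
  let P₁ := sandwich (rightHitAlgHom k H) P e
  let P₂ := sandwich (leftHitAlgHom k H) P₁ (flipOp e)
  have hP₁₁ : ∀ x, P₁ x ∈ N.restrictScalars k := sandwich_apply_mem _ hr hP₁ e
  have hP₁₂ : ∀ x ∈ N.restrictScalars k, P₁ x = x :=
    fun x hx => he.sandwich_apply_eq_self _ hr hP₂ hx
  have hcl : ∀ p, Commute (leftHit p) P₂ := fun p =>
    he.op.commute (leftHitAlgHom k H) P₁ (MulOpposite.op (HopfDual.toDual.symm p))
  have hcr : ∀ p, Commute (rightHit p) P₂ := fun p =>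
    commute_sandwich (leftHitAlgHom k H)
      (he.commute (rightHitAlgHom k H) P (HopfDual.toDual.symm p))
      (fun a => (commute_leftHit_rightHit _ p).symm) _
  let Q : H →ₗ[hitAlgebra k H] H :=
    { toFun := P₂
      map_add' := map_add _
      map_smul' := fun f x =>
        (LinearMap.congr_fun (commute_of_mem_hitAlgebra hcl hcr f.2).eq x).symm }
  refine ⟨LinearMap.ker Q, ?_⟩
  have hQ₁ : ∀ x, Q x ∈ N := sandwich_apply_mem _ hl hP₁₁ _
  have hQ₂ : ∀ x ∈ N, Q x = x := fun x hx => he.op.sandwich_apply_eq_self _ hl hP₁₂ hx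
  exact isCompl_ker_of_projection (R := hitAlgebra k H) (M := H) (N := N) (P := Q) hQ₁ hQ₂

variable (k H) in
lemma trace_antipode_sq_ne_zero_of_isCosemisimple [CharZero k] (h : IsCosemisimple k H) :
    LinearMap.trace k H (𝑺 ∘ₗ 𝑺) ≠ 0 := by
  have := (isCosemisimple_iff_isSemisimpleModule k H).mp h
  have h1 : IsSubcoalgebra k (Submodule.span k {(1 : H)}) := by
    refine isSubcoalgebra_of_hit_mem (fun p x hx => ?_) (fun p x hx => ?_) <;>
    obtain ⟨c, rfl⟩ := Submodule.mem_span_singleton.mp hx <;> rw [map_smul]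
    · rw [leftHit_one]
      exact Submodule.smul_mem _ _ (Submodule.smul_mem _ _ (Submodule.mem_span_singleton_self _))
    · rw [rightHit_one]
      exact Submodule.smul_mem _ _ (Submodule.smul_mem _ _ (Submodule.mem_span_singleton_self _))
  obtain ⟨C, hC⟩ := this.exists_isCompl h1.toSubmodule
  have hCs := isSubcoalgebra_restrictScalars C
  have hdec : ∀ x : H, ∃ c : k, ∃ y ∈ C, x = c • 1 + y := by
    intro x
    have : x ∈ h1.toSubmodule ⊔ C := by rw [hC.sup_eq_top]; trivial
    obtain ⟨z, hz, y, hy, rfl⟩ := Submodule.mem_sup.mp this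
    obtain ⟨c, rfl⟩ := Submodule.mem_span_singleton.mp hz
    exact ⟨c, y, hy, rfl⟩
  have h1C : (1 : H) ∉ C.restrictScalars k := by
    intro h'
    have := Submodule.disjoint_def.mp hC.disjoint 1 (Submodule.mem_span_singleton_self _) h'
    have h2 := congrArg (counit (R := k)) this
    simp at h2
  obtain ⟨f, hf1, hfC⟩ : ∃ f : Module.Dual k H, f 1 = 1 ∧ ∀ y ∈ C, f y = 0 := by
    obtain ⟨f, hf1, hfC⟩ := Submodule.exists_le_ker_of_notMem h1C
    refine ⟨(f 1)⁻¹ • f, by simp [hf1], fun y hy => ?_⟩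
    have : f y = 0 := hfC hy
    simp [this]
  let Λ : HopfDual k H := HopfDual.toDual.symm f
  have hl : IsLeftIntegral k Λ := by
    intro p
    apply HopfDual.toDual.injective
    ext x
    obtain ⟨c, y, hy, rfl⟩ := hdec x
    rw [toDual_mul_eq_comp_leftHit]
    have := hfC _ (hCs.leftHit_mem (HopfDual.toDual p) hy)
    simp [Λ, leftHit_one, hf1, hfC y hy, this, HopfDual.counit_apply, mul_comm]
  have hr : IsRightIntegral k Λ := by
    intro p
    apply HopfDual.toDual.injective
    ext x
    obtain ⟨c, y, hy, rfl⟩ := hdec x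
    rw [toDual_mul_eq_comp_rightHit]
    have := hfC _ (hCs.rightHit_mem (HopfDual.toDual p) hy)
    simp [Λ, rightHit_one, hf1, hfC y hy, this, HopfDual.counit_apply, mul_comm]
  rw [← HopfDual.trace_antipode_sq]
  exact trace_antipode_sq_ne_zero hr hl (by rw [HopfDual.counit_apply]; simpa [Λ] using hf1)

variable (k H) in
lemma trace_antipode_sq_ne_zero_of_isSemisimpleRing [CharZero k] [IsSemisimpleRing H] :
    LinearMap.trace k H (𝑺 ∘ₗ 𝑺) ≠ 0 := by
  obtain ⟨Λ, hl, hr, h1⟩ := exists_isLeftIntegral_isRightIntegral (k := k) (H := H)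
  exact trace_antipode_sq_ne_zero hr hl h1

end Hits

end

/-- (Larson–Radford) Let `H` be a finite-dimensional Hopf algebra over a field of
characteristic `0`.  Then `H` is semisimple iff `H` is cosemisimple, iff `S_H² = id_H`,
iff `tr(S_H²) ≠ 0`. -/
theorem larson_radford_char_zero (k H : Type*) [Field k] [CharZero k] [Ring H]
    [HopfAlgebra k H] [FiniteDimensional k H] :
    (IsSemisimpleRing H ↔ IsCosemisimple k H) ∧
    (IsSemisimpleRing H ↔
      HopfAlgebra.antipode (R := k) (A := H) ∘ₗ HopfAlgebra.antipode (R := k) (A := H) =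
        LinearMap.id) ∧
    (IsSemisimpleRing H ↔
      LinearMap.trace k H
        (HopfAlgebra.antipode (R := k) (A := H) ∘ₗ HopfAlgebra.antipode (R := k) (A := H))
        ≠ 0) := by
  have htr : IsSemisimpleRing H ↔ LinearMap.trace k H
      (HopfAlgebra.antipode (R := k) (A := H) ∘ₗ HopfAlgebra.antipode (R := k) (A := H)) ≠ 0 :=
    ⟨fun _ => trace_antipode_sq_ne_zero_of_isSemisimpleRing k H,
      isSemisimpleRing_of_trace_antipode_sq_ne_zero k H⟩
  refine ⟨htr.trans ⟨isCosemisimple_of_trace_antipode_sq_ne_zero k H,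
    trace_antipode_sq_ne_zero_of_isCosemisimple k H⟩, htr.trans
    ⟨antipode_comp_antipode_of_trace_ne_zero k H, fun h => ?_⟩, htr⟩
  have : Nontrivial H := (Bialgebra.counitAlgHom k H).toRingHom.domain_nontrivial
  rw [h, LinearMap.trace_id]
  exact Nat.cast_ne_zero.mpr Module.finrank_pos.ne'
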